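/- arXiv:2007.03957 — 2 statements merged into one kernel-verified Lean document; each statement's English description precedes it below -/
import Mathlib

section
/- ∑_{n=1}^∞ (−1)ⁿ/(n⁵·2ⁿ·binom(2n,n)) = −10·Li₅(1/2) − 6·Li₄(1/2)·log 2 + (19/2)·ζ(5) − ζ(3)·log²2 − (19/120)·log⁵2 + (1/9)·π²·log³2 − (7/180)·π⁴·log 2. -/
/-- Catalan's constant `C = ∑_{k≥0} (-1)^k/(2k+1)²`. -/
noncomputable def catalanConst : ℝ := ∑' k : ℕ, (-1 : ℝ) ^ k / ((2 * k + 1 : ℕ) : ℝ) ^ 2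

/-- `β(4) = ∑_{k≥0} (-1)^k/(2k+1)⁴`. -/
noncomputable def diriBeta4 : ℝ := ∑' k : ℕ, (-1 : ℝ) ^ k / ((2 * k + 1 : ℕ) : ℝ) ^ 4

/-- The real polylogarithm `Li_s(x) = ∑_{n≥1} xⁿ/n^s`. -/
noncomputable def rpolylog (s : ℕ) (x : ℝ) : ℝ :=
  ∑' n : ℕ, x ^ (n + 1) / ((n + 1 : ℕ) : ℝ) ^ s

/-- The complex polylogarithm `Li_s(z) = ∑_{n≥1} zⁿ/n^s`. -/
noncomputable def cpolylog (s : ℕ) (z : ℂ) : ℂ :=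
  ∑' n : ℕ, z ^ (n + 1) / ((n + 1 : ℕ) : ℂ) ^ s

section Helpers

open Filter Topology Set

/-- The weighted polylogarithm `∑_{n≥1} aₙ xⁿ / nᵏ`, where `a` is indexed from zero. -/
noncomputable def weightedPolylog (a : ℕ → ℝ) (k : ℕ) (x : ℝ) : ℝ :=
  ∑' n : ℕ, a n * x ^ (n + 1) / ((n + 1 : ℕ) : ℝ) ^ k

theorem rpolylog_eq_weightedPolylog (k : ℕ) (x : ℝ) :
    rpolylog k x = weightedPolylog (fun _ => 1) k x := by
  simp only [rpolylog, weightedPolylog, one_mul]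

theorem weightedPolylog_term_bound {a : ℕ → ℝ} (ha : ∀ n, |a n| ≤ 1) (k n : ℕ) (x : ℝ) :
    ‖a n * x ^ (n + 1) / ((n + 1 : ℕ) : ℝ) ^ k‖ ≤ |x| * |x| ^ n := by
  have h1 : (1 : ℝ) ≤ ((n + 1 : ℕ) : ℝ) ^ k :=
    one_le_pow₀ (by push_cast; linarith [n.cast_nonneg (α := ℝ)])
  rw [Real.norm_eq_abs, abs_div, abs_mul, abs_pow,
    abs_of_nonneg (by positivity : (0 : ℝ) ≤ ((n + 1 : ℕ) : ℝ) ^ k)]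
  calc |a n| * |x| ^ (n + 1) / ((n + 1 : ℕ) : ℝ) ^ k ≤ 1 * |x| ^ (n + 1) / 1 := by
        gcongr
        exact ha n
    _ = |x| * |x| ^ n := by ring

theorem summable_weightedPolylog {a : ℕ → ℝ} (ha : ∀ n, |a n| ≤ 1) (k : ℕ) {x : ℝ}
    (hx : |x| < 1) : Summable fun n : ℕ => a n * x ^ (n + 1) / ((n + 1 : ℕ) : ℝ) ^ k :=
  Summable.of_norm_bounded ((summable_geometric_of_lt_one (abs_nonneg x) hx).mul_left |x|)
    (fun n => weightedPolylog_term_bound ha k n x)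

theorem abs_weightedPolylog_le {a : ℕ → ℝ} (ha : ∀ n, |a n| ≤ 1) (k : ℕ) {x : ℝ}
    (hx : |x| ≤ 1 / 2) : |weightedPolylog a k x| ≤ 2 * |x| := by
  have hx1 : |x| < 1 := by linarith
  have h := tsum_of_norm_bounded
    ((hasSum_geometric_of_lt_one (abs_nonneg x) hx1).mul_left |x|)
    (fun n => weightedPolylog_term_bound ha k n x)
  refine h.trans ?_
  rw [mul_comm]
  gcongr
  rw [inv_le_comm₀ (by linarith) (by norm_num)]
  linarith

theorem hasDerivAt_weightedPolylog {a : ℕ → ℝ} (ha : ∀ n, |a n| ≤ 1) (k : ℕ) {x : ℝ}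
    (hx : |x| < 1) (hx0 : x ≠ 0) :
    HasDerivAt (weightedPolylog a (k + 1)) (weightedPolylog a k x / x) x := by
  obtain ⟨r, hxr, hr⟩ := exists_between hx
  have hr0 : 0 ≤ r := (abs_nonneg x).trans hxr.le
  have key := hasDerivAt_tsum_of_isPreconnected (t := Metric.ball (0 : ℝ) r) (y₀ := x) (y := x)
    (g := fun n y => a n * y ^ (n + 1) / ((n + 1 : ℕ) : ℝ) ^ (k + 1))
    (g' := fun n y => a n * y ^ n / ((n + 1 : ℕ) : ℝ) ^ k)
    (summable_geometric_of_lt_one hr0 hr) Metric.isOpen_ball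
    (convex_ball (0 : ℝ) r).isPreconnected ?_ ?_ (by simpa using hxr)
    (summable_weightedPolylog ha (k + 1) hx) (by simpa using hxr)
  · refine key.congr_deriv ?_
    rw [weightedPolylog, ← tsum_div_const]
    refine tsum_congr fun n => ?_
    field_simp
    ring
  · intro n y _
    have h := ((hasDerivAt_pow (n + 1) y).const_mul (a n)).div_const (((n + 1 : ℕ) : ℝ) ^ (k + 1))
    refine h.congr_deriv ?_
    have : ((n + 1 : ℕ) : ℝ) ≠ 0 := by positivity
    rw [Nat.add_sub_cancel]
    field_simp
    ring
  · intro n y hy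
    have hy : |y| ≤ r := by simpa using (Metric.mem_ball.1 hy).le
    have h1 : (1 : ℝ) ≤ ((n + 1 : ℕ) : ℝ) ^ k :=
      one_le_pow₀ (by push_cast; linarith [n.cast_nonneg (α := ℝ)])
    rw [Real.norm_eq_abs, abs_div, abs_mul, abs_pow,
      abs_of_nonneg (by positivity : (0 : ℝ) ≤ ((n + 1 : ℕ) : ℝ) ^ k)]
    calc |a n| * |y| ^ n / ((n + 1 : ℕ) : ℝ) ^ k ≤ 1 * r ^ n / 1 := by
          gcongr
          exact ha n
      _ = r ^ n := by ring

theorem summable_one_div_succ_pow {k : ℕ} (hk : 2 ≤ k) :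
    Summable fun n : ℕ => 1 / ((n + 1 : ℕ) : ℝ) ^ k :=
  (summable_nat_add_iff 1).2 (Real.summable_one_div_nat_pow.2 hk)

theorem continuousOn_rpolylog {k : ℕ} (hk : 2 ≤ k) : ContinuousOn (rpolylog k) (Icc (-1) 1) := by
  refine continuousOn_tsum (fun n => by fun_prop) (summable_one_div_succ_pow hk) ?_
  intro n x hx
  rw [norm_div, norm_pow, norm_pow, Real.norm_natCast]
  gcongr
  exact pow_le_one₀ (norm_nonneg x) (abs_le.2 hx)

theorem rpolylog_one {x : ℝ} (hx : |x| < 1) : rpolylog 1 x = -Real.log (1 - x) := by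
  rw [← (Real.hasSum_pow_div_log_of_abs_lt_one hx).tsum_eq, rpolylog]
  simp

theorem hasDerivAt_rpolylog (k : ℕ) {x : ℝ} (hx : |x| < 1) (hx0 : x ≠ 0) :
    HasDerivAt (rpolylog (k + 1)) (rpolylog k x / x) x := by
  have h := hasDerivAt_weightedPolylog (a := fun _ => 1) (by simp) k hx hx0
  simpa only [← rpolylog_eq_weightedPolylog, ← funext (rpolylog_eq_weightedPolylog _)] using h

theorem abs_rpolylog_le (k : ℕ) {x : ℝ} (hx : |x| ≤ 1 / 2) : |rpolylog k x| ≤ 2 * |x| := by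
  rw [rpolylog_eq_weightedPolylog]
  exact abs_weightedPolylog_le (by simp) k hx

theorem rpolylog_neg_one {k : ℕ} (hk : 2 ≤ k) :
    rpolylog k (-1) = (2 / 2 ^ k - 1) * rpolylog k 1 := by
  have hs : Summable fun n : ℕ => (1 : ℝ) ^ (n + 1) / ((n + 1 : ℕ) : ℝ) ^ k := by
    simpa only [one_pow] using summable_one_div_succ_pow hk
  have hs' : Summable fun n : ℕ => (-1 : ℝ) ^ (n + 1) / ((n + 1 : ℕ) : ℝ) ^ k := by
    refine Summable.of_norm_bounded hs fun n => ?_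
    rw [norm_div, norm_pow, norm_pow, Real.norm_natCast, norm_neg, norm_one]
  let f : ℕ → ℝ := fun n =>
    (1 : ℝ) ^ (n + 1) / ((n + 1 : ℕ) : ℝ) ^ k + (-1 : ℝ) ^ (n + 1) / ((n + 1 : ℕ) : ℝ) ^ k
  have hf : Summable f := hs.add hs'
  have hadd : rpolylog k 1 + rpolylog k (-1) = ∑' n, f n := (hs.tsum_add hs').symm
  have heven : ∀ m : ℕ, f (2 * m) = 0 := fun m => by
    simp only [f, one_pow, pow_succ, pow_mul]
    ring
  have hodd : ∀ m : ℕ, f (2 * m + 1)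
      = 2 / 2 ^ k * ((1 : ℝ) ^ (m + 1) / ((m + 1 : ℕ) : ℝ) ^ k) := fun m => by
    have hcast : ((2 * m + 1 + 1 : ℕ) : ℝ) = 2 * ((m + 1 : ℕ) : ℝ) := by push_cast; ring
    have hpow : (-1 : ℝ) ^ (2 * m + 1 + 1) = 1 := Even.neg_one_pow ⟨m + 1, by ring⟩
    simp only [f, hcast, hpow, mul_pow, one_pow]
    field_simp
    norm_num
  have hsplit := tsum_even_add_odd (f := f)
    (hf.comp_injective (mul_right_injective₀ (two_ne_zero (α := ℕ))))
    (hf.comp_injective ((add_left_injective 1).comp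
      (mul_right_injective₀ (two_ne_zero (α := ℕ)))))
  simp only [heven, hodd, tsum_zero, zero_add, tsum_mul_left] at hsplit
  have hone : rpolylog k 1 = ∑' n : ℕ, (1 : ℝ) ^ (n + 1) / ((n + 1 : ℕ) : ℝ) ^ k := rfl
  rw [← hone, ← hadd] at hsplit
  linarith

/-- A function on `(0, b]` with vanishing derivative is equal to its limit at zero. -/
theorem eq_of_hasDerivAt_zero_of_tendsto {f : ℝ → ℝ} {b c : ℝ} (hf : ContinuousOn f (Ioc 0 b))
    (hd : ∀ w ∈ Ioo 0 b, HasDerivAt f 0 w) (hl : Tendsto f (𝓝[>] 0) (𝓝 c)) {x : ℝ}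
    (hx : x ∈ Ioc 0 b) : f x = c := by
  have hev : ∀ᶠ e in 𝓝[>] (0 : ℝ), f e = f x := by
    filter_upwards [Ioo_mem_nhdsGT hx.1] with e he
    refine (constant_of_has_deriv_right_zero
      (hf.mono fun y hy => ⟨he.1.trans_le hy.1, hy.2.trans hx.2⟩)
      (fun y hy => (hd y ⟨he.1.trans_le hy.1, hy.2.trans_le hx.2⟩).hasDerivWithinAt)
      x ⟨he.2.le, le_rfl⟩).symm
  exact tendsto_nhds_unique (tendsto_const_nhds.congr' (hev.mono fun _ h => h.symm)) hl

/-- A function that tends to zero at `0⁺` even after multiplication by any power of `log`. -/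
def LogNegligible (f : ℝ → ℝ) : Prop :=
  ∀ i : ℕ, Tendsto (fun w => Real.log w ^ i * f w) (𝓝[>] 0) (𝓝 0)

namespace LogNegligible

variable {f g : ℝ → ℝ}

theorem tendsto (hf : LogNegligible f) : Tendsto f (𝓝[>] 0) (𝓝 0) := by
  simpa using hf 0

theorem congr (hf : LogNegligible f) (h : ∀ w, f w = g w) : LogNegligible g :=
  funext h ▸ hf

theorem of_abs_le (c : ℝ) (h : ∀ w ∈ Ioo (0 : ℝ) (1 / 4), |f w| ≤ c * w) : LogNegligible f := by
  intro i
  have hlim : Tendsto (fun w : ℝ => c * |Real.log w ^ i * w|) (𝓝[>] 0) (𝓝 0) := by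
    have h1 : Tendsto (fun w : ℝ => Real.log w ^ i * w) (𝓝[>] 0) (𝓝 0) := by
      have h2 := (tendsto_log_mul_rpow_nhdsGT_zero
        (show (0 : ℝ) < 1 / (i + 1 : ℕ) by positivity)).pow i
      have h3 : Tendsto (fun w : ℝ => w ^ (1 / ((i + 1 : ℕ) : ℝ))) (𝓝[>] 0) (𝓝 0) := by
        have := (Real.continuousAt_rpow_const 0 (1 / ((i + 1 : ℕ) : ℝ))
          (Or.inr (by positivity))).tendsto
        rw [Real.zero_rpow (by positivity)] at this
        exact this.mono_left nhdsWithin_le_nhds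
      have h4 := h2.mul h3
      rw [mul_zero] at h4
      refine h4.congr' ?_
      filter_upwards [self_mem_nhdsWithin] with w hw
      have hw : (0 : ℝ) < w := hw
      rw [mul_pow, mul_assoc, ← pow_succ, ← Real.rpow_natCast (w ^ _), ← Real.rpow_mul hw.le,
        one_div_mul_cancel (by positivity), Real.rpow_one]
    simpa using h1.abs.const_mul c
  refine squeeze_zero_norm' ?_ hlim
  filter_upwards [Ioo_mem_nhdsGT (show (0 : ℝ) < 1 / 4 by norm_num)] with w hw
  rw [Real.norm_eq_abs, abs_mul, abs_mul, abs_of_pos hw.1]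
  nlinarith [h w hw, abs_nonneg (Real.log w ^ i)]

theorem add (hf : LogNegligible f) (hg : LogNegligible g) :
    LogNegligible fun w => f w + g w := fun i => by
  simpa only [mul_add, add_zero] using (hf i).add (hg i)

theorem const_mul (hf : LogNegligible f) (c : ℝ) : LogNegligible fun w => c * f w := fun i => by
  simpa only [mul_left_comm, mul_zero] using (hf i).const_mul c

theorem sub (hf : LogNegligible f) (hg : LogNegligible g) :
    LogNegligible fun w => f w - g w := fun i => by
  simpa only [mul_sub, sub_zero] using (hf i).sub (hg i)

theorem mul_tendsto (hf : LogNegligible f) {c : ℝ} (hg : Tendsto g (𝓝[>] 0) (𝓝 c)) :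
    LogNegligible fun w => f w * g w := fun i => by
  simpa only [mul_assoc, zero_mul] using (hf i).mul hg

theorem log_mul (hf : LogNegligible f) : LogNegligible fun w => Real.log w * f w := fun i => by
  simpa only [pow_succ, mul_assoc] using hf (i + 1)

end LogNegligible

/-- `log (1 - w)`. -/
noncomputable def reflLog (w : ℝ) : ℝ := Real.log (1 - w)

/-- `Li_k (1 - w)`. -/
noncomputable def reflPolylog (k : ℕ) (w : ℝ) : ℝ := rpolylog k (1 - w)

/-- `Li_k (-w / (1 - w))`. -/
noncomputable def landenPolylog (k : ℕ) (w : ℝ) : ℝ := rpolylog k (-(w / (1 - w)))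

/-- `∑_{n≥1} xⁿ / (nᵏ C(2n,n))` at `x = -w² / (1 - w)`. -/
noncomputable def centralBinomPolylog (k : ℕ) (w : ℝ) : ℝ :=
  weightedPolylog (fun n => 1 / ((n + 1).centralBinom : ℝ)) k (-(w ^ 2 / (1 - w)))

theorem abs_one_div_centralBinom_le (n : ℕ) : |1 / ((n + 1).centralBinom : ℝ)| ≤ 1 := by
  have h : (1 : ℝ) ≤ (n + 1).centralBinom := by exact_mod_cast Nat.centralBinom_pos (n + 1)
  rw [abs_of_nonneg (by positivity), div_le_one (by positivity)]
  exact h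

theorem abs_neg_div_one_sub {w : ℝ} (hw : w ∈ Ioc (0 : ℝ) (1 / 2)) :
    |-(w / (1 - w))| = w / (1 - w) := by
  rw [abs_neg, abs_of_nonneg (div_nonneg hw.1.le (by linarith [hw.2]))]

theorem abs_neg_sq_div_one_sub {w : ℝ} (hw : w ∈ Ioc (0 : ℝ) (1 / 2)) :
    |-(w ^ 2 / (1 - w))| = w ^ 2 / (1 - w) := by
  rw [abs_neg, abs_of_nonneg (div_nonneg (sq_nonneg w) (by linarith [hw.2]))]

theorem sq_div_one_sub_le {w : ℝ} (hw : w ∈ Ioc (0 : ℝ) (1 / 2)) : w ^ 2 / (1 - w) ≤ 1 / 2 := by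
  rw [div_le_iff₀ (by linarith [hw.2])]
  nlinarith [hw.1, hw.2]

theorem hasDerivAt_reflLog {w : ℝ} (hw : w ∈ Ioo (0 : ℝ) 1) :
    HasDerivAt reflLog (-(1 / (1 - w))) w := by
  have h := ((hasDerivAt_id w).const_sub 1).log (by simp only [id]; linarith [hw.2])
  exact h.congr_deriv (by simp only [id]; ring)

theorem hasDerivAt_reflPolylog (k : ℕ) {w : ℝ} (hw : w ∈ Ioo (0 : ℝ) 1) :
    HasDerivAt (reflPolylog (k + 1)) (-(reflPolylog k w / (1 - w))) w := by
  have h1 : |1 - w| < 1 := abs_lt.2 ⟨by linarith [hw.2], by linarith [hw.1]⟩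
  have h := (hasDerivAt_rpolylog k h1 (by linarith [hw.2])).comp w
    ((hasDerivAt_id w).const_sub 1)
  exact h.congr_deriv (by rw [reflPolylog]; ring)

theorem hasDerivAt_landenPolylog (k : ℕ) {w : ℝ} (hw : w ∈ Ioo (0 : ℝ) (1 / 2)) :
    HasDerivAt (landenPolylog (k + 1)) (landenPolylog k w * (1 / w + 1 / (1 - w))) w := by
  have h0 : 0 < w := hw.1
  have h1 : 0 < 1 - w := by linarith [hw.2]
  have habs : |-(w / (1 - w))| < 1 := by
    rw [abs_neg_div_one_sub (Ioo_subset_Ioc_self hw), div_lt_one h1]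
    linarith [hw.2]
  have hin := ((hasDerivAt_id w).div ((hasDerivAt_id w).const_sub 1) h1.ne').neg
  have h := (hasDerivAt_rpolylog k habs (by simp [h0.ne', h1.ne'])).comp w hin
  refine h.congr_deriv ?_
  rw [landenPolylog]
  simp only [id]
  field_simp
  ring

theorem hasDerivAt_centralBinomPolylog (k : ℕ) {w : ℝ} (hw : w ∈ Ioo (0 : ℝ) (1 / 2)) :
    HasDerivAt (centralBinomPolylog (k + 1))
      (centralBinomPolylog k w * (2 / w + 1 / (1 - w))) w := by
  have h0 : 0 < w := hw.1
  have h1 : 0 < 1 - w := by linarith [hw.2]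
  have habs : |-(w ^ 2 / (1 - w))| < 1 := by
    rw [abs_neg_sq_div_one_sub (Ioo_subset_Ioc_self hw)]
    linarith [sq_div_one_sub_le (Ioo_subset_Ioc_self hw)]
  have hin := (((hasDerivAt_id w).pow 2).div ((hasDerivAt_id w).const_sub 1) h1.ne').neg
  have h := (hasDerivAt_weightedPolylog abs_one_div_centralBinom_le k habs
    (by simp [h0.ne', h1.ne'])).comp w hin
  refine h.congr_deriv ?_
  rw [centralBinomPolylog]
  simp only [id, Pi.pow_apply]
  field_simp
  ring

theorem rpolylog_one_eq_neg_reflLog {w : ℝ} (hw : w ∈ Ioo (0 : ℝ) 1) :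
    rpolylog 1 w = -reflLog w :=
  rpolylog_one (abs_lt.2 ⟨by linarith [hw.1], hw.2⟩)

theorem reflPolylog_one {w : ℝ} (hw : w ∈ Ioo (0 : ℝ) 1) : reflPolylog 1 w = -Real.log w := by
  rw [reflPolylog, rpolylog_one (abs_lt.2 ⟨by linarith [hw.2], by linarith [hw.1]⟩), sub_sub_cancel]

theorem landenPolylog_one {w : ℝ} (hw : w ∈ Ioo (0 : ℝ) (1 / 2)) :
    landenPolylog 1 w = reflLog w := by
  have h1 : 0 < 1 - w := by linarith [hw.2]
  have habs : |-(w / (1 - w))| < 1 := by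
    rw [abs_neg_div_one_sub (Ioo_subset_Ioc_self hw), div_lt_one h1]
    linarith [hw.2]
  have harg : 1 - -(w / (1 - w)) = (1 - w)⁻¹ := by
    field_simp
    ring
  rw [landenPolylog, rpolylog_one habs, harg, Real.log_inv, neg_neg, reflLog]

theorem hasDerivAt_rpolylog_two {w : ℝ} (hw : w ∈ Ioo (0 : ℝ) 1) :
    HasDerivAt (rpolylog 2) (-(reflLog w / w)) w := by
  have h := hasDerivAt_rpolylog 1 (abs_lt.2 ⟨by linarith [hw.1], hw.2⟩) hw.1.ne'
  rwa [rpolylog_one_eq_neg_reflLog hw, neg_div] at h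

theorem hasDerivAt_reflPolylog_two {w : ℝ} (hw : w ∈ Ioo (0 : ℝ) 1) :
    HasDerivAt (reflPolylog 2) (Real.log w / (1 - w)) w := by
  have h := hasDerivAt_reflPolylog 1 hw
  rwa [reflPolylog_one hw, neg_div, neg_neg] at h

theorem hasDerivAt_landenPolylog_two {w : ℝ} (hw : w ∈ Ioo (0 : ℝ) (1 / 2)) :
    HasDerivAt (landenPolylog 2) (reflLog w * (1 / w + 1 / (1 - w))) w := by
  have h := hasDerivAt_landenPolylog 1 hw
  rwa [landenPolylog_one hw] at h

theorem continuousOn_reflLog : ContinuousOn reflLog (Ioc 0 (1 / 2)) := fun w hw =>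
  (hasDerivAt_reflLog ⟨hw.1, by linarith [hw.2]⟩).continuousAt.continuousWithinAt

theorem continuousOn_rpolylog_half {k : ℕ} (hk : 2 ≤ k) :
    ContinuousOn (rpolylog k) (Ioc 0 (1 / 2)) :=
  (continuousOn_rpolylog hk).mono fun w hw => ⟨by linarith [hw.1], by linarith [hw.2]⟩

theorem continuousOn_reflPolylog {k : ℕ} (hk : 2 ≤ k) :
    ContinuousOn (reflPolylog k) (Ioc 0 (1 / 2)) :=
  (continuousOn_rpolylog hk).comp (by fun_prop)
    fun w hw => ⟨by linarith [hw.2], by linarith [hw.1]⟩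

theorem continuousOn_landenPolylog {k : ℕ} (hk : 2 ≤ k) :
    ContinuousOn (landenPolylog k) (Ioc 0 (1 / 2)) := by
  refine (continuousOn_rpolylog hk).comp
    (continuousOn_id.div (continuousOn_const.sub continuousOn_id)
      fun w hw => (by linarith [hw.2] : (0 : ℝ) < 1 - w).ne').neg fun w hw => abs_le.1 ?_
  change |-(w / (1 - w))| ≤ 1
  rw [abs_neg_div_one_sub hw, div_le_one (by linarith [hw.2])]
  linarith [hw.2]

theorem continuousOn_centralBinomPolylog (k : ℕ) :
    ContinuousOn (centralBinomPolylog (k + 1)) (Ioc 0 (1 / 2)) := by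
  intro w hw
  have h0 : 0 < w := hw.1
  have h1 : 0 < 1 - w := by linarith [hw.2]
  have habs : |-(w ^ 2 / (1 - w))| < 1 := by
    rw [abs_neg_sq_div_one_sub hw]
    linarith [sq_div_one_sub_le hw]
  refine ContinuousAt.continuousWithinAt ?_
  refine ContinuousAt.comp (f := fun w => -(w ^ 2 / (1 - w)))
    (hasDerivAt_weightedPolylog abs_one_div_centralBinom_le k habs
      (by simp [h0.ne', h1.ne'])).continuousAt ?_
  fun_prop (disch := exact h1.ne')

theorem logNegligible_reflLog : LogNegligible reflLog := by
  refine .of_abs_le 2 fun w hw => ?_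
  have h1 : 0 < 1 - w := by linarith [hw.2]
  rw [reflLog, abs_of_nonpos (Real.log_nonpos h1.le (by linarith [hw.1]))]
  have h2 := Real.one_sub_inv_le_log_of_pos h1
  have h3 : (1 - w)⁻¹ ≤ 1 + 2 * w := by
    rw [inv_le_iff_one_le_mul₀ h1]
    nlinarith [hw.1, hw.2]
  linarith

theorem logNegligible_rpolylog (k : ℕ) : LogNegligible (rpolylog k) := by
  refine .of_abs_le 2 fun w hw => ?_
  have h := abs_rpolylog_le k (x := w) (by rw [abs_of_pos hw.1]; linarith [hw.2])
  rwa [abs_of_pos hw.1] at h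

theorem logNegligible_landenPolylog (k : ℕ) : LogNegligible (landenPolylog k) := by
  refine .of_abs_le 4 fun w hw => ?_
  have hw' : w ∈ Ioc (0 : ℝ) (1 / 2) := ⟨hw.1, by linarith [hw.2]⟩
  have h1 : 0 < 1 - w := by linarith [hw.2]
  have h2 : w / (1 - w) ≤ 2 * w := by
    rw [div_le_iff₀ h1]
    nlinarith [hw.1, hw.2]
  have h := abs_rpolylog_le k (x := -(w / (1 - w)))
    (by rw [abs_neg_div_one_sub hw']; linarith [hw.2])
  rw [abs_neg_div_one_sub hw'] at h
  rw [landenPolylog]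
  linarith

theorem abs_centralBinomPolylog_le (k : ℕ) {w : ℝ} (hw : w ∈ Ioc (0 : ℝ) (1 / 2)) :
    |centralBinomPolylog k w| ≤ 4 * w ^ 2 := by
  have h1 : 0 < 1 - w := by linarith [hw.2]
  have h2 : w ^ 2 / (1 - w) ≤ 2 * w ^ 2 := by
    rw [div_le_iff₀ h1]
    nlinarith [mul_nonneg (sq_nonneg w) (by linarith [hw.2] : (0 : ℝ) ≤ 1 - 2 * w)]
  have h := abs_weightedPolylog_le abs_one_div_centralBinom_le k (x := -(w ^ 2 / (1 - w)))
    (by rw [abs_neg_sq_div_one_sub hw]; exact sq_div_one_sub_le hw)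
  rw [abs_neg_sq_div_one_sub hw] at h
  rw [centralBinomPolylog]
  linarith

theorem logNegligible_centralBinomPolylog (k : ℕ) : LogNegligible (centralBinomPolylog k) := by
  refine .of_abs_le 4 fun w hw => ?_
  have h := abs_centralBinomPolylog_le k (w := w) ⟨hw.1, by linarith [hw.2]⟩
  nlinarith [hw.1, hw.2]

theorem tendsto_reflPolylog {k : ℕ} (hk : 2 ≤ k) :
    Tendsto (reflPolylog k) (𝓝[>] 0) (𝓝 (rpolylog k 1)) := by
  refine ((continuousOn_rpolylog hk) 1 ⟨by norm_num, le_rfl⟩).tendsto.comp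
    (tendsto_nhdsWithin_iff.2 ⟨?_, ?_⟩)
  · have h : Tendsto (fun w : ℝ => 1 - w) (𝓝 0) (𝓝 (1 - 0)) :=
      (continuous_const.sub continuous_id).tendsto 0
    rw [sub_zero] at h
    exact h.mono_left nhdsWithin_le_nhds
  · filter_upwards [Ioo_mem_nhdsGT (show (0 : ℝ) < 1 by norm_num)] with w hw
    exact ⟨by linarith [hw.2], by linarith [hw.1]⟩

theorem four_sub_mul_weightedPolylog_zero {x : ℝ} (hx : |x| < 1) :
    (4 - x) * weightedPolylog (fun n => 1 / ((n + 1).centralBinom : ℝ)) 0 x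
      = 2 * weightedPolylog (fun n => 1 / ((n + 1).centralBinom : ℝ)) 1 x + x := by
  have h0 := summable_weightedPolylog abs_one_div_centralBinom_le 0 hx
  have h1 := summable_weightedPolylog abs_one_div_centralBinom_le 1 hx
  have hterm : ∀ n : ℕ,
      4 * (1 / ((n + 1).centralBinom : ℝ) * x ^ (n + 1) / ((n + 1 : ℕ) : ℝ) ^ 0)
        - 2 * (1 / ((n + 1).centralBinom : ℝ) * x ^ (n + 1) / ((n + 1 : ℕ) : ℝ) ^ 1)
      = 1 / (n.centralBinom : ℝ) * x ^ (n + 1) := fun n => by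
    have hrec : ((n + 1 : ℕ) : ℝ) * ((n + 1).centralBinom : ℝ)
        = 2 * (2 * n + 1) * (n.centralBinom : ℝ) := by
      exact_mod_cast Nat.succ_mul_centralBinom_succ n
    have hc : ((n + 1).centralBinom : ℝ) ≠ 0 := by exact_mod_cast (n + 1).centralBinom_ne_zero
    have hc' : (n.centralBinom : ℝ) ≠ 0 := by exact_mod_cast n.centralBinom_ne_zero
    have hn : ((n + 1 : ℕ) : ℝ) ≠ 0 := by positivity
    have hcoef : 4 * (1 / ((n + 1).centralBinom : ℝ))
        - 2 * (1 / ((n + 1).centralBinom : ℝ) / ((n + 1 : ℕ) : ℝ)) = 1 / (n.centralBinom : ℝ) := by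
      field_simp
      push_cast at hrec ⊢
      linarith
    rw [← hcoef]
    ring
  have hsum : Summable fun n : ℕ => 1 / (n.centralBinom : ℝ) * x ^ (n + 1) :=
    ((h0.mul_left 4).sub (h1.mul_left 2)).congr hterm
  have hleft := (h0.mul_left 4).tsum_sub (h1.mul_left 2)
  simp only [hterm] at hleft
  rw [hsum.tsum_eq_zero_add, tsum_mul_left, tsum_mul_left] at hleft
  have hshift : ∑' n : ℕ, 1 / ((n + 1).centralBinom : ℝ) * x ^ (n + 1 + 1)
      = x * weightedPolylog (fun n => 1 / ((n + 1).centralBinom : ℝ)) 0 x := by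
    rw [weightedPolylog, ← tsum_mul_left]
    exact tsum_congr fun n => by ring
  rw [hshift, Nat.centralBinom_zero] at hleft
  simp only [weightedPolylog] at hleft ⊢
  push_cast at hleft ⊢
  linarith

/-- `f` is a primitive of `g` on `(0, 1/2)`, continuous on `(0, 1/2]`, with limit `c` at `0`. -/
structure PrimitiveFromZero (f g : ℝ → ℝ) (c : ℝ) : Prop where
  continuousOn : ContinuousOn f (Ioc 0 (1 / 2))
  hasDerivAt : ∀ w ∈ Ioo (0 : ℝ) (1 / 2), HasDerivAt f (g w) w
  tendsto : Tendsto f (𝓝[>] 0) (𝓝 c)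

namespace PrimitiveFromZero

variable {f f' g g' : ℝ → ℝ} {c c' : ℝ}

theorem add (h : PrimitiveFromZero f g c) (h' : PrimitiveFromZero f' g' c') :
    PrimitiveFromZero (fun w => f w + f' w) (fun w => g w + g' w) (c + c') :=
  ⟨h.continuousOn.add h'.continuousOn, fun w hw => (h.hasDerivAt w hw).add (h'.hasDerivAt w hw),
    h.tendsto.add h'.tendsto⟩

theorem sub (h : PrimitiveFromZero f g c) (h' : PrimitiveFromZero f' g' c') :
    PrimitiveFromZero (fun w => f w - f' w) (fun w => g w - g' w) (c - c') :=
  ⟨h.continuousOn.sub h'.continuousOn, fun w hw => (h.hasDerivAt w hw).sub (h'.hasDerivAt w hw),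
    h.tendsto.sub h'.tendsto⟩

theorem const_mul (h : PrimitiveFromZero f g c) (a : ℝ) :
    PrimitiveFromZero (fun w => a * f w) (fun w => a * g w) (a * c) :=
  ⟨continuousOn_const.mul h.continuousOn, fun w hw => (h.hasDerivAt w hw).const_mul a,
    h.tendsto.const_mul a⟩

theorem eq_of_deriv_eq_zero (h : PrimitiveFromZero f g c)
    (hg : ∀ w ∈ Ioo (0 : ℝ) (1 / 2), g w = 0) {x : ℝ} (hx : x ∈ Ioc (0 : ℝ) (1 / 2)) : f x = c :=
  eq_of_hasDerivAt_zero_of_tendsto h.continuousOn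
    (fun w hw => hg w hw ▸ h.hasDerivAt w hw) h.tendsto hx

end PrimitiveFromZero

theorem continuousOn_log_half : ContinuousOn Real.log (Ioc 0 (1 / 2)) :=
  Real.continuousOn_log.mono fun _ hw => hw.1.ne'

theorem primitiveFromZero_centralBinomPolylog_one :
    PrimitiveFromZero (fun w => (2 / w - 1) * centralBinomPolylog 1 w - reflLog w)
      (fun _ => 0) 0 := by
  have hB := continuousOn_reflLog
  have hS := continuousOn_centralBinomPolylog 0
  refine ⟨?_, fun w hw => ?_, ?_⟩
  · have hinv : ContinuousOn (fun w : ℝ => 2 / w) (Ioc 0 (1 / 2)) :=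
      continuousOn_const.div continuousOn_id fun w hw => hw.1.ne'
    exact ((hinv.sub continuousOn_const).mul hS).sub hB
  · have h0 : 0 < w := hw.1
    have h1 : 0 < 1 - w := by linarith [hw.2]
    have h2 : 0 < 2 - w := by linarith [hw.2]
    have hS' := hasDerivAt_centralBinomPolylog 0 hw
    have hB' := hasDerivAt_reflLog (w := w) ⟨hw.1, by linarith [hw.2]⟩
    have hinv := ((hasDerivAt_inv h0.ne').const_mul 2).sub_const 1
    have h := (hinv.mul hS').sub hB'
    have habs : |-(w ^ 2 / (1 - w))| < 1 := by
      rw [abs_neg_sq_div_one_sub (Ioo_subset_Ioc_self hw)]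
      linarith [sq_div_one_sub_le (Ioo_subset_Ioc_self hw)]
    have hode : (4 - -(w ^ 2 / (1 - w))) * centralBinomPolylog 0 w
        = 2 * centralBinomPolylog 1 w + -(w ^ 2 / (1 - w)) :=
      four_sub_mul_weightedPolylog_zero habs
    have hS0 : centralBinomPolylog 0 w
        = (2 * centralBinomPolylog 1 w * (1 - w) - w ^ 2) / (2 - w) ^ 2 := by
      field_simp at hode ⊢
      linarith
    simp only [div_eq_mul_inv]
    simp only [div_eq_mul_inv] at h
    refine h.congr_deriv ?_
    simp only [zero_add]
    rw [hS0]
    field_simp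
    ring
  · have hS1 : Tendsto (fun w => (2 / w - 1) * centralBinomPolylog 1 w) (𝓝[>] 0) (𝓝 0) := by
      have hlim : Tendsto (fun w : ℝ => 8 * w) (𝓝[>] 0) (𝓝 0) := by
        have h : Tendsto (fun w : ℝ => 8 * w) (𝓝 0) (𝓝 (8 * 0)) :=
          (continuous_const.mul continuous_id).tendsto 0
        rw [mul_zero] at h
        exact h.mono_left nhdsWithin_le_nhds
      refine squeeze_zero_norm' ?_ hlim
      filter_upwards [Ioo_mem_nhdsGT (show (0 : ℝ) < 1 / 2 by norm_num)] with w hw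
      have h0 : 0 < w := hw.1
      have hfac : 0 ≤ 2 / w - 1 := by
        rw [sub_nonneg, le_div_iff₀ h0]
        linarith [hw.2]
      rw [Real.norm_eq_abs, abs_mul, abs_of_nonneg hfac]
      calc (2 / w - 1) * |centralBinomPolylog 1 w| ≤ (2 / w) * (4 * w ^ 2) := by
            gcongr
            · linarith
            · exact abs_centralBinomPolylog_le 1 (Ioo_subset_Ioc_self hw)
        _ = 8 * w := by
            field_simp
            norm_num
    simpa using hS1.sub logNegligible_reflLog.tendsto

theorem centralBinomPolylog_one {w : ℝ} (hw : w ∈ Ioc (0 : ℝ) (1 / 2)) :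
    centralBinomPolylog 1 w = w * reflLog w / (2 - w) := by
  have h := primitiveFromZero_centralBinomPolylog_one.eq_of_deriv_eq_zero (fun _ _ => rfl) hw
  have h0 : 0 < w := hw.1
  have h2 : 0 < 2 - w := by linarith [hw.2]
  field_simp at h ⊢
  linarith

/-- `∑_{n≥1} xⁿ / (n² C(2n,n)) = -log² (1 - w) / 2` for `x = -w² / (1 - w)`. -/
theorem centralBinomPolylog_two {w : ℝ} (hw : w ∈ Ioc (0 : ℝ) (1 / 2)) :
    centralBinomPolylog 2 w = -(reflLog w ^ 2 / 2) := by
  have hprim : PrimitiveFromZero (fun w => centralBinomPolylog 2 w + 1 / 2 * reflLog w ^ 2)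
      (fun _ => 0) 0 := by
    refine ⟨(continuousOn_centralBinomPolylog 1).add
      (continuousOn_const.mul (continuousOn_reflLog.pow 2)), fun w hw => ?_, ?_⟩
    · have h0 : 0 < w := hw.1
      have h1 : 0 < 1 - w := by linarith [hw.2]
      have h2 : 0 < 2 - w := by linarith [hw.2]
      have h := (hasDerivAt_centralBinomPolylog 1 hw).add
        (((hasDerivAt_reflLog (w := w) ⟨hw.1, by linarith [hw.2]⟩).pow 2).const_mul (1 / 2))
      refine h.congr_deriv ?_
      rw [centralBinomPolylog_one (Ioo_subset_Ioc_self hw)]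
      field_simp
      ring
    · have h := (logNegligible_centralBinomPolylog 2).tendsto.add
        ((logNegligible_reflLog.tendsto.pow 2).const_mul (1 / 2))
      rwa [zero_pow two_ne_zero, mul_zero, add_zero] at h
  have h := hprim.eq_of_deriv_eq_zero (fun _ _ => rfl) hw
  linarith

theorem hasDerivAt_centralBinomPolylog_three {w : ℝ} (hw : w ∈ Ioo (0 : ℝ) (1 / 2)) :
    HasDerivAt (centralBinomPolylog 3) (-(reflLog w ^ 2 / 2) * (2 / w + 1 / (1 - w))) w := by
  have h := hasDerivAt_centralBinomPolylog 2 hw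
  rwa [centralBinomPolylog_two (Ioo_subset_Ioc_self hw)] at h

section Primitives

open Real

theorem hasDerivAt_log_half {w : ℝ} (hw : w ∈ Ioo (0 : ℝ) (1 / 2)) :
    HasDerivAt log (1 / w) w :=
  (Real.hasDerivAt_log hw.1.ne').congr_deriv (one_div w).symm

theorem hasDerivAt_reflLog_half {w : ℝ} (hw : w ∈ Ioo (0 : ℝ) (1 / 2)) :
    HasDerivAt reflLog (-(1 / (1 - w))) w :=
  hasDerivAt_reflLog ⟨hw.1, by linarith [hw.2]⟩

theorem hasDerivAt_rpolylog_two_half {w : ℝ} (hw : w ∈ Ioo (0 : ℝ) (1 / 2)) :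
    HasDerivAt (rpolylog 2) (-(reflLog w / w)) w :=
  hasDerivAt_rpolylog_two ⟨hw.1, by linarith [hw.2]⟩

theorem hasDerivAt_rpolylog_half (k : ℕ) {w : ℝ} (hw : w ∈ Ioo (0 : ℝ) (1 / 2)) :
    HasDerivAt (rpolylog (k + 1)) (rpolylog k w / w) w :=
  hasDerivAt_rpolylog k (abs_lt.2 ⟨by linarith [hw.1], by linarith [hw.2]⟩) hw.1.ne'

theorem hasDerivAt_reflPolylog_two_half {w : ℝ} (hw : w ∈ Ioo (0 : ℝ) (1 / 2)) :
    HasDerivAt (reflPolylog 2) (log w / (1 - w)) w :=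
  hasDerivAt_reflPolylog_two ⟨hw.1, by linarith [hw.2]⟩

theorem hasDerivAt_reflPolylog_half (k : ℕ) {w : ℝ} (hw : w ∈ Ioo (0 : ℝ) (1 / 2)) :
    HasDerivAt (reflPolylog (k + 1)) (-(reflPolylog k w / (1 - w))) w :=
  hasDerivAt_reflPolylog k ⟨hw.1, by linarith [hw.2]⟩

/-- Primitive of `log w * log (1 - w) / w`. -/
theorem primitiveFromZero_log_mul_reflLog :
    PrimitiveFromZero (fun w => rpolylog 3 w - log w * rpolylog 2 w)
      (fun w => log w * reflLog w / w) 0 := by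
  have hA := continuousOn_log_half
  have hP2 := continuousOn_rpolylog_half (k := 2) (by norm_num)
  have hP3 := continuousOn_rpolylog_half (k := 3) (by norm_num)
  refine ⟨hP3.sub (hA.mul hP2), fun w hw => ?_, ?_⟩
  · have h0 : 0 < w := hw.1
    have h := (hasDerivAt_rpolylog_half 2 hw).sub
      ((hasDerivAt_log_half hw).mul (hasDerivAt_rpolylog_two_half hw))
    refine h.congr_deriv ?_
    field_simp
    ring
  · exact ((logNegligible_rpolylog 3).sub (logNegligible_rpolylog 2).log_mul).tendsto

/-- Primitive of `log² w * log (1 - w) / w`. -/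
theorem primitiveFromZero_log_sq_mul_reflLog :
    PrimitiveFromZero
      (fun w => 2 * (log w * rpolylog 3 w) - log w ^ 2 * rpolylog 2 w - 2 * rpolylog 4 w)
      (fun w => log w ^ 2 * reflLog w / w) 0 := by
  have hA := continuousOn_log_half
  have hP2 := continuousOn_rpolylog_half (k := 2) (by norm_num)
  have hP3 := continuousOn_rpolylog_half (k := 3) (by norm_num)
  have hP4 := continuousOn_rpolylog_half (k := 4) (by norm_num)
  refine ⟨by fun_prop, fun w hw => ?_, ?_⟩
  · have h0 : 0 < w := hw.1
    have dA := hasDerivAt_log_half hw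
    have h := (((dA.mul (hasDerivAt_rpolylog_half 2 hw)).const_mul 2).sub
      ((dA.pow 2).mul (hasDerivAt_rpolylog_two_half hw))).sub
      ((hasDerivAt_rpolylog_half 3 hw).const_mul 2)
    refine h.congr_deriv ?_
    simp only [Pi.pow_apply]
    field_simp
    ring
  · have n2 := logNegligible_rpolylog 2
    have n3 := logNegligible_rpolylog 3
    have n4 := logNegligible_rpolylog 4
    exact (((n3.log_mul.const_mul 2).sub n2.log_mul.log_mul).sub (n4.const_mul 2)).congr
      (fun w => by ring) |>.tendsto

/-- Primitive of `log³ w * log (1 - w) / w`. -/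
theorem primitiveFromZero_log_cube_mul_reflLog :
    PrimitiveFromZero
      (fun w => 3 * (log w ^ 2 * rpolylog 3 w) - log w ^ 3 * rpolylog 2 w
        - 6 * (log w * rpolylog 4 w) + 6 * rpolylog 5 w)
      (fun w => log w ^ 3 * reflLog w / w) 0 := by
  have hA := continuousOn_log_half
  have hP2 := continuousOn_rpolylog_half (k := 2) (by norm_num)
  have hP3 := continuousOn_rpolylog_half (k := 3) (by norm_num)
  have hP4 := continuousOn_rpolylog_half (k := 4) (by norm_num)
  have hP5 := continuousOn_rpolylog_half (k := 5) (by norm_num)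
  refine ⟨by fun_prop, fun w hw => ?_, ?_⟩
  · have h0 : 0 < w := hw.1
    have dA := hasDerivAt_log_half hw
    have h := (((((dA.pow 2).mul (hasDerivAt_rpolylog_half 2 hw)).const_mul 3).sub
      ((dA.pow 3).mul (hasDerivAt_rpolylog_two_half hw))).sub
      ((dA.mul (hasDerivAt_rpolylog_half 3 hw)).const_mul 6)).add
      ((hasDerivAt_rpolylog_half 4 hw).const_mul 6)
    refine h.congr_deriv ?_
    simp only [Pi.pow_apply]
    field_simp
    ring
  · have n2 := logNegligible_rpolylog 2
    have n3 := logNegligible_rpolylog 3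
    have n4 := logNegligible_rpolylog 4
    have n5 := logNegligible_rpolylog 5
    exact ((((n3.log_mul.log_mul.const_mul 3).sub n2.log_mul.log_mul.log_mul).sub
      (n4.log_mul.const_mul 6)).add (n5.const_mul 6)).congr (fun w => by ring) |>.tendsto

/-- Primitive of `log² (1 - w) / w`. -/
theorem primitiveFromZero_reflLog_sq :
    PrimitiveFromZero
      (fun w => reflLog w ^ 2 * log w + 2 * (reflLog w * reflPolylog 2 w) - 2 * reflPolylog 3 w)
      (fun w => reflLog w ^ 2 / w) (-2 * rpolylog 3 1) := by
  have hA := continuousOn_log_half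
  have hB := continuousOn_reflLog
  have hQ2 := continuousOn_reflPolylog (k := 2) (by norm_num)
  have hQ3 := continuousOn_reflPolylog (k := 3) (by norm_num)
  refine ⟨by fun_prop, fun w hw => ?_, ?_⟩
  · have h0 : 0 < w := hw.1
    have h1 : 0 < 1 - w := by linarith [hw.2]
    have dA := hasDerivAt_log_half hw
    have dB := hasDerivAt_reflLog_half hw
    have h := (((dB.pow 2).mul dA).add
      ((dB.mul (hasDerivAt_reflPolylog_two_half hw)).const_mul 2)).sub
      ((hasDerivAt_reflPolylog_half 2 hw).const_mul 2)
    refine h.congr_deriv ?_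
    simp only [Pi.pow_apply]
    field_simp
    ring
  · have nB := logNegligible_reflLog
    have h := ((nB.mul_tendsto nB.log_mul.tendsto).add
      ((nB.mul_tendsto (tendsto_reflPolylog (k := 2) (by norm_num))).const_mul 2)).tendsto.sub
      ((tendsto_reflPolylog (k := 3) (by norm_num)).const_mul 2)
    rw [zero_sub, ← neg_mul] at h
    exact h.congr fun w => by ring

/-- Primitive of `log⁴ (1 - w) / w`. -/
theorem primitiveFromZero_reflLog_pow_four :
    PrimitiveFromZero
      (fun w => reflLog w ^ 4 * log w + 4 * (reflLog w ^ 3 * reflPolylog 2 w)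
        - 12 * (reflLog w ^ 2 * reflPolylog 3 w) + 24 * (reflLog w * reflPolylog 4 w)
        - 24 * reflPolylog 5 w)
      (fun w => reflLog w ^ 4 / w) (-24 * rpolylog 5 1) := by
  have hA := continuousOn_log_half
  have hB := continuousOn_reflLog
  have hQ2 := continuousOn_reflPolylog (k := 2) (by norm_num)
  have hQ3 := continuousOn_reflPolylog (k := 3) (by norm_num)
  have hQ4 := continuousOn_reflPolylog (k := 4) (by norm_num)
  have hQ5 := continuousOn_reflPolylog (k := 5) (by norm_num)
  refine ⟨by fun_prop, fun w hw => ?_, ?_⟩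
  · have h0 : 0 < w := hw.1
    have h1 : 0 < 1 - w := by linarith [hw.2]
    have dA := hasDerivAt_log_half hw
    have dB := hasDerivAt_reflLog_half hw
    have h := (((((dB.pow 4).mul dA).add
      (((dB.pow 3).mul (hasDerivAt_reflPolylog_two_half hw)).const_mul 4)).sub
      (((dB.pow 2).mul (hasDerivAt_reflPolylog_half 2 hw)).const_mul 12)).add
      ((dB.mul (hasDerivAt_reflPolylog_half 3 hw)).const_mul 24)).sub
      ((hasDerivAt_reflPolylog_half 4 hw).const_mul 24)
    refine h.congr_deriv ?_
    simp only [Pi.pow_apply]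
    field_simp
    ring
  · have nB := logNegligible_reflLog
    have tB := nB.tendsto
    have h := ((((nB.log_mul.mul_tendsto (tB.pow 3)).add
      (((nB.mul_tendsto (tB.pow 2)).mul_tendsto
        (tendsto_reflPolylog (k := 2) (by norm_num))).const_mul 4)).sub
      (((nB.mul_tendsto tB).mul_tendsto
        (tendsto_reflPolylog (k := 3) (by norm_num))).const_mul 12)).add
      ((nB.mul_tendsto (tendsto_reflPolylog (k := 4) (by norm_num))).const_mul 24)).tendsto.sub
      ((tendsto_reflPolylog (k := 5) (by norm_num)).const_mul 24)
    rw [zero_sub, ← neg_mul] at h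
    exact h.congr fun w => by ring

theorem LogNegligible.log_sub_reflLog_mul {f : ℝ → ℝ} (hf : LogNegligible f) :
    LogNegligible fun w => (log w - reflLog w) * f w :=
  (hf.log_mul.sub (hf.mul_tendsto logNegligible_reflLog.tendsto)).congr fun w => by ring

theorem hasDerivAt_log_sub_reflLog {w : ℝ} (hw : w ∈ Ioo (0 : ℝ) (1 / 2)) :
    HasDerivAt (fun w => log w - reflLog w) (1 / w + 1 / (1 - w)) w :=
  ((hasDerivAt_log_half hw).sub (hasDerivAt_reflLog_half hw)).congr_deriv (by ring)

/-- Primitive of `log w * log (1 - w) / w - log² (1 - w) / (2 w)`, in terms of Landen's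
transformation. -/
theorem primitiveFromZero_landen_three :
    PrimitiveFromZero
      (fun w => (log w - reflLog w) * landenPolylog 2 w - landenPolylog 3 w
        + (log w * reflLog w ^ 2 / 2 - reflLog w ^ 3 / 3))
      (fun w => (log w * reflLog w - reflLog w ^ 2 / 2) / w) 0 := by
  have hA := continuousOn_log_half
  have hB := continuousOn_reflLog
  have hN2 := continuousOn_landenPolylog (k := 2) (by norm_num)
  have hN3 := continuousOn_landenPolylog (k := 3) (by norm_num)
  refine ⟨by fun_prop, fun w hw => ?_, ?_⟩
  · have h0 : 0 < w := hw.1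
    have h1 : 0 < 1 - w := by linarith [hw.2]
    have dA := hasDerivAt_log_half hw
    have dB := hasDerivAt_reflLog_half hw
    have dC := hasDerivAt_log_sub_reflLog hw
    have h := ((dC.mul (hasDerivAt_landenPolylog_two hw)).sub
      (hasDerivAt_landenPolylog 2 hw)).add
      (((dA.mul (dB.pow 2)).div_const 2).sub ((dB.pow 3).div_const 3))
    refine h.congr_deriv ?_
    simp only [Pi.pow_apply]
    field_simp
    ring
  · have nB := logNegligible_reflLog
    have tB := nB.tendsto
    have n2 := logNegligible_landenPolylog 2
    have n3 := logNegligible_landenPolylog 3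
    exact ((n2.log_sub_reflLog_mul.sub n3).add
      (((nB.log_mul.mul_tendsto tB).const_mul (1 / 2)).sub
        ((nB.mul_tendsto (tB.pow 2)).const_mul (1 / 3)))).congr (fun w => by ring) |>.tendsto

/-- Primitive of `(log² w * log (1 - w) - log w * log² (1 - w) + log³ (1 - w) / 3) / w`, in terms
of Landen's transformation. -/
theorem primitiveFromZero_landen_four :
    PrimitiveFromZero
      (fun w => (log w - reflLog w) ^ 2 * landenPolylog 2 w
        - 2 * ((log w - reflLog w) * landenPolylog 3 w) + 2 * landenPolylog 4 w
        + (log w ^ 2 * reflLog w ^ 2 / 2 - 2 * (log w * reflLog w ^ 3) / 3 + reflLog w ^ 4 / 4))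
      (fun w => (log w ^ 2 * reflLog w - log w * reflLog w ^ 2 + reflLog w ^ 3 / 3) / w) 0 := by
  have hA := continuousOn_log_half
  have hB := continuousOn_reflLog
  have hN2 := continuousOn_landenPolylog (k := 2) (by norm_num)
  have hN3 := continuousOn_landenPolylog (k := 3) (by norm_num)
  have hN4 := continuousOn_landenPolylog (k := 4) (by norm_num)
  refine ⟨by fun_prop, fun w hw => ?_, ?_⟩
  · have h0 : 0 < w := hw.1
    have h1 : 0 < 1 - w := by linarith [hw.2]
    have dA := hasDerivAt_log_half hw
    have dB := hasDerivAt_reflLog_half hw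
    have dC := hasDerivAt_log_sub_reflLog hw
    have h := ((((dC.pow 2).mul (hasDerivAt_landenPolylog_two hw)).sub
      ((dC.mul (hasDerivAt_landenPolylog 2 hw)).const_mul 2)).add
      ((hasDerivAt_landenPolylog 3 hw).const_mul 2)).add
      (((((dA.pow 2).mul (dB.pow 2)).div_const 2).sub
        (((dA.mul (dB.pow 3)).const_mul 2).div_const 3)).add ((dB.pow 4).div_const 4))
    refine h.congr_deriv ?_
    simp only [Pi.pow_apply]
    field_simp
    ring
  · have nB := logNegligible_reflLog
    have tB := nB.tendsto
    have n2 := logNegligible_landenPolylog 2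
    have n3 := logNegligible_landenPolylog 3
    have n4 := logNegligible_landenPolylog 4
    exact (((n2.log_sub_reflLog_mul.log_sub_reflLog_mul.sub
      (n3.log_sub_reflLog_mul.const_mul 2)).add (n4.const_mul 2)).add
      ((((nB.log_mul.log_mul.mul_tendsto tB).const_mul (1 / 2)).sub
        ((nB.log_mul.mul_tendsto (tB.pow 2)).const_mul (2 / 3))).add
        ((nB.mul_tendsto (tB.pow 3)).const_mul (1 / 4)))).congr (fun w => by ring) |>.tendsto

/-- Primitive of `(log³ w * log (1 - w) - (3/2) log² w * log² (1 - w) + log w * log³ (1 - w)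
- log⁴ (1 - w) / 4) / w`, in terms of Landen's transformation. -/
theorem primitiveFromZero_landen_five :
    PrimitiveFromZero
      (fun w => (log w - reflLog w) ^ 3 * landenPolylog 2 w
        - 3 * ((log w - reflLog w) ^ 2 * landenPolylog 3 w)
        + 6 * ((log w - reflLog w) * landenPolylog 4 w) - 6 * landenPolylog 5 w
        + (log w ^ 3 * reflLog w ^ 2 / 2 - log w ^ 2 * reflLog w ^ 3
          + 3 * (log w * reflLog w ^ 4) / 4 - reflLog w ^ 5 / 5))
      (fun w => (log w ^ 3 * reflLog w - 3 / 2 * (log w ^ 2 * reflLog w ^ 2)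
        + log w * reflLog w ^ 3 - reflLog w ^ 4 / 4) / w) 0 := by
  have hA := continuousOn_log_half
  have hB := continuousOn_reflLog
  have hN2 := continuousOn_landenPolylog (k := 2) (by norm_num)
  have hN3 := continuousOn_landenPolylog (k := 3) (by norm_num)
  have hN4 := continuousOn_landenPolylog (k := 4) (by norm_num)
  have hN5 := continuousOn_landenPolylog (k := 5) (by norm_num)
  refine ⟨by fun_prop, fun w hw => ?_, ?_⟩
  · have h0 : 0 < w := hw.1
    have h1 : 0 < 1 - w := by linarith [hw.2]
    have dA := hasDerivAt_log_half hw
    have dB := hasDerivAt_reflLog_half hw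
    have dC := hasDerivAt_log_sub_reflLog hw
    have h := (((((dC.pow 3).mul (hasDerivAt_landenPolylog_two hw)).sub
      (((dC.pow 2).mul (hasDerivAt_landenPolylog 2 hw)).const_mul 3)).add
      ((dC.mul (hasDerivAt_landenPolylog 3 hw)).const_mul 6)).sub
      ((hasDerivAt_landenPolylog 4 hw).const_mul 6)).add
      ((((((dA.pow 3).mul (dB.pow 2)).div_const 2).sub ((dA.pow 2).mul (dB.pow 3))).add
        (((dA.mul (dB.pow 4)).const_mul 3).div_const 4)).sub ((dB.pow 5).div_const 5))
    refine h.congr_deriv ?_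
    simp only [Pi.pow_apply]
    field_simp
    ring
  · have nB := logNegligible_reflLog
    have tB := nB.tendsto
    have n2 := logNegligible_landenPolylog 2
    have n3 := logNegligible_landenPolylog 3
    have n4 := logNegligible_landenPolylog 4
    have n5 := logNegligible_landenPolylog 5
    exact ((((n2.log_sub_reflLog_mul.log_sub_reflLog_mul.log_sub_reflLog_mul.sub
      (n3.log_sub_reflLog_mul.log_sub_reflLog_mul.const_mul 3)).add
      (n4.log_sub_reflLog_mul.const_mul 6)).sub (n5.const_mul 6)).add
      (((((nB.log_mul.log_mul.log_mul.mul_tendsto tB).const_mul (1 / 2)).sub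
        (nB.log_mul.log_mul.mul_tendsto (tB.pow 2))).add
        ((nB.log_mul.mul_tendsto (tB.pow 3)).const_mul (3 / 4))).sub
        ((nB.mul_tendsto (tB.pow 4)).const_mul (1 / 5)))).congr (fun w => by ring) |>.tendsto

theorem LogNegligible.affine_mul {f : ℝ → ℝ} (hf : LogNegligible f) (l : ℝ) :
    LogNegligible fun w => (2 * log w + l) * f w :=
  ((hf.log_mul.const_mul 2).add (hf.const_mul l)).congr fun w => by ring

theorem LogNegligible.argument_mul {f : ℝ → ℝ} (hf : LogNegligible f) (l : ℝ) :
    LogNegligible fun w => (reflLog w - 2 * log w - l) * f w :=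
  ((hf.mul_tendsto logNegligible_reflLog.tendsto).sub (hf.affine_mul l)).congr fun w => by ring

/-- Taylor-type combination of the central binomial sums of weights three to five; the factor
`log (1 - w) - 2 log w - l` is the logarithm of the ratio of the arguments `-exp (-l)` and
`-w² / (1 - w)`. -/
theorem primitiveFromZero_centralBinomPolylog_five (l : ℝ) :
    PrimitiveFromZero
      (fun w => centralBinomPolylog 5 w + (reflLog w - 2 * log w - l) * centralBinomPolylog 4 w
        + (reflLog w - 2 * log w - l) ^ 2 * centralBinomPolylog 3 w / 2
        - reflLog w ^ 2 * (reflLog w - 2 * log w - l) ^ 3 / 12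
        - ((2 * log w + l) ^ 3 * reflLog w ^ 2 / 2 - (2 * log w + l) ^ 2 * reflLog w ^ 3
          + 3 * ((2 * log w + l) * reflLog w ^ 4) / 4 - reflLog w ^ 5 / 5) / 6)
      (fun w => -((2 * log w + l) ^ 2 * reflLog w ^ 2 / 2
        - 2 * ((2 * log w + l) * reflLog w ^ 3) / 3 + reflLog w ^ 4 / 4) / w) 0 := by
  have hA := continuousOn_log_half
  have hB := continuousOn_reflLog
  have hS3 := continuousOn_centralBinomPolylog 2
  have hS4 := continuousOn_centralBinomPolylog 3
  have hS5 := continuousOn_centralBinomPolylog 4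
  refine ⟨by fun_prop, fun w hw => ?_, ?_⟩
  · have h0 : 0 < w := hw.1
    have h1 : 0 < 1 - w := by linarith [hw.2]
    have dA := hasDerivAt_log_half hw
    have dB := hasDerivAt_reflLog_half hw
    have dM := (dB.sub (dA.const_mul 2)).sub_const l
    have dX := (dA.const_mul 2).add_const l
    have h := ((((hasDerivAt_centralBinomPolylog 4 hw).add
      (dM.mul (hasDerivAt_centralBinomPolylog 3 hw))).add
      (((dM.pow 2).mul (hasDerivAt_centralBinomPolylog_three hw)).div_const 2)).sub
      (((dB.pow 2).mul (dM.pow 3)).div_const 12)).sub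
      (((((((dX.pow 3).mul (dB.pow 2)).div_const 2).sub ((dX.pow 2).mul (dB.pow 3))).add
        (((dX.mul (dB.pow 4)).const_mul 3).div_const 4)).sub ((dB.pow 5).div_const 5)).div_const 6)
    refine h.congr_deriv ?_
    simp only [Pi.pow_apply, Pi.sub_apply]
    field_simp
    ring
  · have nB := logNegligible_reflLog
    have tB := nB.tendsto
    have n3 := logNegligible_centralBinomPolylog 3
    have n4 := logNegligible_centralBinomPolylog 4
    have n5 := logNegligible_centralBinomPolylog 5
    exact ((((n5.add (n4.argument_mul l)).add
      (((n3.argument_mul l).argument_mul l).const_mul (1 / 2))).sub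
      (((((nB.mul_tendsto tB).argument_mul l).argument_mul l).argument_mul l).const_mul
        (1 / 12))).sub
      (((((((((nB.mul_tendsto tB).affine_mul l).affine_mul l).affine_mul l).const_mul (1 / 2)).sub
        (((nB.mul_tendsto (tB.pow 2)).affine_mul l).affine_mul l)).add
        (((nB.mul_tendsto (tB.pow 3)).affine_mul l).const_mul (3 / 4))).sub
        ((nB.mul_tendsto (tB.pow 4)).const_mul (1 / 5))).const_mul (1 / 6))).congr
      (fun w => by ring) |>.tendsto

theorem half_mem_Ioc : (1 / 2 : ℝ) ∈ Ioc (0 : ℝ) (1 / 2) := ⟨by norm_num, le_rfl⟩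

theorem log_half : log (1 / 2) = -log 2 := by rw [one_div, log_inv]

theorem reflLog_half : reflLog (1 / 2) = -log 2 := by
  rw [reflLog, ← log_half]
  norm_num

theorem reflPolylog_half (k : ℕ) : reflPolylog k (1 / 2) = rpolylog k (1 / 2) := by
  rw [reflPolylog]
  norm_num

theorem landenPolylog_half {k : ℕ} (hk : 2 ≤ k) :
    landenPolylog k (1 / 2) = (2 / 2 ^ k - 1) * rpolylog k 1 := by
  rw [← rpolylog_neg_one hk, landenPolylog]
  norm_num

/-- Euler's value of the dilogarithm at `1/2`. -/
theorem rpolylog_two_half : rpolylog 2 (1 / 2) = (rpolylog 2 1 - log 2 ^ 2) / 2 := by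
  have hprim : PrimitiveFromZero
      (fun w => rpolylog 2 w + reflPolylog 2 w + log w * reflLog w) (fun _ => 0)
      (rpolylog 2 1) := by
    have hA := continuousOn_log_half
    have hB := continuousOn_reflLog
    have hP2 := continuousOn_rpolylog_half (k := 2) (by norm_num)
    have hQ2 := continuousOn_reflPolylog (k := 2) (by norm_num)
    refine ⟨by fun_prop, fun w hw => ?_, ?_⟩
    · have h0 : 0 < w := hw.1
      have h1 : 0 < 1 - w := by linarith [hw.2]
      have h := ((hasDerivAt_rpolylog_two_half hw).add (hasDerivAt_reflPolylog_two_half hw)).add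
        ((hasDerivAt_log_half hw).mul (hasDerivAt_reflLog_half hw))
      refine h.congr_deriv ?_
      field_simp
      ring
    · have h := ((logNegligible_rpolylog 2).tendsto.add
        (tendsto_reflPolylog (k := 2) le_rfl)).add logNegligible_reflLog.log_mul.tendsto
      rwa [zero_add, add_zero] at h
  have h := hprim.eq_of_deriv_eq_zero (fun _ _ => rfl) half_mem_Ioc
  simp only [log_half, reflLog_half, reflPolylog_half] at h
  linarith

/-- Landen's value of the trilogarithm at `1/2`. -/
theorem rpolylog_three_half : rpolylog 3 (1 / 2)
    = 7 / 8 * rpolylog 3 1 - log 2 * rpolylog 2 1 / 2 + log 2 ^ 3 / 6 := by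
  have h := ((primitiveFromZero_landen_three.sub primitiveFromZero_log_mul_reflLog).add
    (primitiveFromZero_reflLog_sq.const_mul (1 / 2))).eq_of_deriv_eq_zero
    (fun w _ => by ring) half_mem_Ioc
  simp only [log_half, reflLog_half, reflPolylog_half, rpolylog_two_half,
    landenPolylog_half (show 2 ≤ 3 by norm_num), landenPolylog_half (show 2 ≤ 2 by norm_num)] at h
  linarith

theorem centralBinomPolylog_five_half : centralBinomPolylog 5 (1 / 2)
    = -10 * rpolylog 5 (1 / 2) - 6 * rpolylog 4 (1 / 2) * log 2 + 19 / 2 * rpolylog 5 1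
      - rpolylog 3 1 * log 2 ^ 2 - 19 / 120 * log 2 ^ 5 + 2 / 3 * rpolylog 2 1 * log 2 ^ 3
      - 7 / 2 * rpolylog 4 1 * log 2 := by
  have h := ((((primitiveFromZero_centralBinomPolylog_five (log 2)).sub
    (((primitiveFromZero_landen_five.sub primitiveFromZero_log_cube_mul_reflLog).add
      (primitiveFromZero_reflLog_pow_four.const_mul (1 / 4))).const_mul (4 / 3))).add
    ((primitiveFromZero_log_sq_mul_reflLog.sub primitiveFromZero_landen_four).const_mul
      (2 * log 2))).add
    ((primitiveFromZero_reflLog_sq.const_mul (log 2 ^ 2 / 2)).add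
      (primitiveFromZero_reflLog_pow_four.const_mul (1 / 4)))).eq_of_deriv_eq_zero
    (fun w _ => by ring) half_mem_Ioc
  simp only [log_half, reflLog_half, reflPolylog_half, rpolylog_two_half, rpolylog_three_half,
    landenPolylog_half (show 2 ≤ 2 by norm_num), landenPolylog_half (show 2 ≤ 3 by norm_num),
    landenPolylog_half (show 2 ≤ 4 by norm_num), landenPolylog_half (show 2 ≤ 5 by norm_num)] at h
  linear_combination h

end Primitives

theorem riemannZeta_eq_rpolylog {k : ℕ} (hk : 2 ≤ k) : riemannZeta k = (rpolylog k 1 : ℂ) := by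
  have hs : Summable fun n : ℕ => 1 / (n : ℝ) ^ k := Real.summable_one_div_nat_pow.2 hk
  have h : rpolylog k 1 = ∑' n : ℕ, 1 / (n : ℝ) ^ k := by
    rw [hs.tsum_eq_zero_add, rpolylog, Nat.cast_zero, zero_pow (by omega), div_zero, zero_add]
    exact tsum_congr fun n => by rw [one_pow]
  rw [h, zeta_nat_eq_tsum_of_gt_one (by omega), Complex.ofReal_tsum]
  exact tsum_congr fun n => by push_cast; rfl

theorem tsum_eq_centralBinomPolylog_five_half :
    ∑' n : ℕ, (-1 : ℝ) ^ (n + 1) / (((n + 1 : ℕ) : ℝ) ^ 5 * 2 ^ (n + 1)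
        * (Nat.choose (2 * (n + 1)) (n + 1) : ℝ)) = centralBinomPolylog 5 (1 / 2) := by
  rw [centralBinomPolylog, weightedPolylog]
  refine tsum_congr fun n => ?_
  have hx : (-((1 / 2 : ℝ) ^ 2 / (1 - 1 / 2))) = -1 / 2 := by norm_num
  rw [hx, Nat.centralBinom_eq_two_mul_choose, div_pow]
  have hc : ((Nat.choose (2 * (n + 1)) (n + 1) : ℕ) : ℝ) ≠ 0 := by
    exact_mod_cast (Nat.choose_pos (by omega)).ne'
  field_simp

end Helpers

/-- `∑_{n=1}^∞ (−1)ⁿ/(n⁵·2ⁿ·C(2n,n)) = −10·Li₅(1/2) − 6·Li₄(1/2)·log 2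
+ (19/2)ζ(5) − ζ(3)·log²2 − (19/120)log⁵2 + (1/9)π²log³2 − (7/180)π⁴·log 2`. -/
theorem statement16 :
    ((∑' n : ℕ, (-1 : ℝ) ^ (n + 1) / (((n + 1 : ℕ) : ℝ) ^ 5 * 2 ^ (n + 1)
        * (Nat.choose (2 * (n + 1)) (n + 1) : ℝ)) : ℝ) : ℂ)
      = -10 * (rpolylog 5 (1 / 2) : ℂ) - 6 * (rpolylog 4 (1 / 2) : ℂ) * (Real.log 2 : ℂ)
        + 19 / 2 * riemannZeta 5 - riemannZeta 3 * (Real.log 2 : ℂ) ^ 2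
        - 19 / 120 * (Real.log 2 : ℂ) ^ 5
        + 1 / 9 * (Real.pi : ℂ) ^ 2 * (Real.log 2 : ℂ) ^ 3
        - 7 / 180 * (Real.pi : ℂ) ^ 4 * (Real.log 2 : ℂ) := by
  have h2 := riemannZeta_eq_rpolylog (k := 2) (by norm_num)
  have h3 := riemannZeta_eq_rpolylog (k := 3) (by norm_num)
  have h4 := riemannZeta_eq_rpolylog (k := 4) (by norm_num)
  have h5 := riemannZeta_eq_rpolylog (k := 5) (by norm_num)
  push_cast at h2 h3 h4 h5
  rw [riemannZeta_two] at h2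
  rw [riemannZeta_four] at h4
  rw [tsum_eq_centralBinomPolylog_five_half, centralBinomPolylog_five_half, h3, h5]
  push_cast
  rw [← h2, ← h4]
  ring
end

section
/- Let ζ(5̄,1) = ∑_{n > m ≥ 1} (−1)ⁿ/(n⁵·m) and S₆ = ∑_{n=1}^∞ (−1)ⁿ/(n⁶·2ⁿ·binom(2n,n)). Then ζ(5̄,1) = 8·Li₆(1/2) + 3·Li₅(1/2)·log 2 + S₆/2 + ζ(3)²/2 − (1/6)·ζ(3)·log³2 + (19/4)·ζ(5)·log 2 − π⁶/112 − (19/1440)·log⁶2 + (1/72)·π²·log⁴2 − (7/720)·π⁴·log²2. -/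
/-- The alternating double zeta value `ζ(5̄,1) = ∑_{n > m ≥ 1} (−1)ⁿ/(n⁵ m)`. -/
noncomputable def zetaBar5_1 : ℝ :=
  ∑' n : ℕ, ((-1 : ℝ) ^ n / (n : ℝ) ^ 5) * ∑ m ∈ Finset.Ico 1 n, (1 : ℝ) / (m : ℝ)

/-- `S₆ = ∑_{n=1}^∞ (−1)ⁿ/(n⁶·2ⁿ·C(2n,n))`. -/
noncomputable def S6 : ℝ :=
  ∑' n : ℕ, (-1 : ℝ) ^ (n + 1) / (((n + 1 : ℕ) : ℝ) ^ 6 * 2 ^ (n + 1)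
    * (Nat.choose (2 * (n + 1)) (n + 1) : ℝ))

namespace AltDoubleZeta

open Filter Topology

/-- The Dirichlet-type power series `∑_{n≥1} c_{n-1} zⁿ/n^j`. -/
noncomputable def pl (c : ℕ → ℝ) (j : ℕ) (z : ℝ) : ℝ :=
  ∑' n : ℕ, c n * z ^ (n + 1) / ((n : ℝ) + 1) ^ j

/-- Coefficient sequences of at most square-root growth. -/
def SqrtGrowth (c : ℕ → ℝ) : Prop := ∀ n, |c n| ≤ 2 * √((n : ℝ) + 1)

lemma summable_sqrt_div_sq : Summable fun n : ℕ => 2 * √((n : ℝ) + 1) / ((n : ℝ) + 1) ^ 2 := by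
  have h : Summable fun n : ℕ => 2 * (1 / |(n : ℝ) + 1| ^ (3 / 2 : ℝ)) :=
    ((Real.summable_one_div_nat_add_rpow 1 (3 / 2)).2 (by norm_num)).mul_left 2
  refine h.congr fun n => ?_
  have hn : (0 : ℝ) < (n : ℝ) + 1 := by positivity
  rw [abs_of_pos hn, Real.sqrt_eq_rpow, mul_div_assoc, ← Real.rpow_natCast, ← Real.rpow_sub hn,
    one_div, ← Real.rpow_neg hn.le]
  norm_num

lemma summable_sqrt_mul_geometric {ρ : ℝ} (h0 : 0 ≤ ρ) (h1 : ρ < 1) :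
    Summable fun n : ℕ => 2 * √((n : ℝ) + 1) * ((n : ℝ) + 1) * ρ ^ n := by
  have hρ : ‖ρ‖ < 1 := by rwa [Real.norm_of_nonneg h0]
  have h := ((summable_pow_mul_geometric_of_norm_lt_one 2 hρ).add
    ((summable_pow_mul_geometric_of_norm_lt_one 1 hρ).mul_left 2)).add
    (summable_pow_mul_geometric_of_norm_lt_one 0 hρ)
  refine Summable.of_nonneg_of_le (fun n => by positivity) (fun n => ?_) (h.mul_left 2)
  have hs : √((n : ℝ) + 1) ≤ (n : ℝ) + 1 := by
    rw [Real.sqrt_le_left (by positivity)]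
    nlinarith [(Nat.cast_nonneg n : (0 : ℝ) ≤ n)]
  have : √((n : ℝ) + 1) * ((n : ℝ) + 1) ≤ ((n : ℝ) + 1) * ((n : ℝ) + 1) := by gcongr
  calc 2 * √((n : ℝ) + 1) * ((n : ℝ) + 1) * ρ ^ n
      = 2 * (√((n : ℝ) + 1) * ((n : ℝ) + 1)) * ρ ^ n := by ring
    _ ≤ 2 * (((n : ℝ) + 1) * ((n : ℝ) + 1)) * ρ ^ n := by gcongr
    _ = _ := by ring

variable {c : ℕ → ℝ}

lemma norm_term_le (hc : SqrtGrowth c) {j : ℕ} (hj : 2 ≤ j) {z : ℝ} (hz : |z| ≤ 1) (n : ℕ) :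
    ‖c n * z ^ (n + 1) / ((n : ℝ) + 1) ^ j‖ ≤ 2 * √((n : ℝ) + 1) / ((n : ℝ) + 1) ^ 2 := by
  have hn : (1 : ℝ) ≤ (n : ℝ) + 1 := by linarith [(Nat.cast_nonneg n : (0 : ℝ) ≤ n)]
  rw [norm_div, norm_mul, Real.norm_of_nonneg (by positivity : (0 : ℝ) ≤ ((n : ℝ) + 1) ^ j),
    norm_pow, Real.norm_eq_abs, Real.norm_eq_abs]
  have h1 : |c n| * |z| ^ (n + 1) ≤ 2 * √((n : ℝ) + 1) * 1 :=
    mul_le_mul (hc n) (pow_le_one₀ (abs_nonneg z) hz) (by positivity) (by positivity)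
  rw [mul_one] at h1
  exact div_le_div₀ (by positivity) h1 (by positivity) (pow_le_pow_right₀ hn hj)

lemma summable_pl (hc : SqrtGrowth c) {j : ℕ} (hj : 2 ≤ j) {z : ℝ} (hz : |z| ≤ 1) :
    Summable fun n : ℕ => c n * z ^ (n + 1) / ((n : ℝ) + 1) ^ j :=
  Summable.of_norm_bounded summable_sqrt_div_sq (norm_term_le hc hj hz)

lemma continuousOn_pl (hc : SqrtGrowth c) {j : ℕ} (hj : 2 ≤ j) :
    ContinuousOn (pl c j) (Set.Icc (-1) 1) :=
  continuousOn_tsum (fun n => by fun_prop) summable_sqrt_div_sq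
    fun n _ hx => norm_term_le hc hj (abs_le.2 hx) n

lemma summable_pl_of_lt (hc : SqrtGrowth c) (j : ℕ) {z : ℝ} (hz : |z| < 1) :
    Summable fun n : ℕ => c n * z ^ (n + 1) / ((n : ℝ) + 1) ^ j := by
  refine Summable.of_norm_bounded (summable_sqrt_mul_geometric (abs_nonneg z) hz) fun n => ?_
  have hn : (1 : ℝ) ≤ (n : ℝ) + 1 := by linarith [(Nat.cast_nonneg n : (0 : ℝ) ≤ n)]
  rw [norm_div, norm_mul, Real.norm_of_nonneg (by positivity : (0 : ℝ) ≤ ((n : ℝ) + 1) ^ j),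
    norm_pow, Real.norm_eq_abs, Real.norm_eq_abs]
  refine (div_le_self (by positivity) (one_le_pow₀ hn)).trans ?_
  have h1 : |z| ^ (n + 1) ≤ |z| ^ n := pow_le_pow_of_le_one (abs_nonneg z) hz.le n.le_succ
  calc |c n| * |z| ^ (n + 1) ≤ 2 * √((n : ℝ) + 1) * |z| ^ n :=
        mul_le_mul (hc n) h1 (by positivity) (by positivity)
    _ ≤ 2 * √((n : ℝ) + 1) * ((n : ℝ) + 1) * |z| ^ n :=
        mul_le_mul_of_nonneg_right (le_mul_of_one_le_right (by positivity) hn) (by positivity)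

lemma hasDerivAt_pl_aux (hc : SqrtGrowth c) (j : ℕ) {z : ℝ} (hz : |z| < 1) :
    HasDerivAt (pl c (j + 1)) (∑' n : ℕ, c n * z ^ n / ((n : ℝ) + 1) ^ j) z := by
  obtain ⟨ρ, h1, h2⟩ := exists_between hz
  have h0 : 0 ≤ ρ := (abs_nonneg z).trans h1.le
  refine hasDerivAt_tsum_of_isPreconnected (t := Set.Ioo (-ρ) ρ) (y₀ := z)
    (g' := fun n y => c n * y ^ n / ((n : ℝ) + 1) ^ j)
    (summable_sqrt_mul_geometric h0 h2) isOpen_Ioo isPreconnected_Ioo (fun n y _ => ?_)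
    (fun n y hy => ?_) (abs_lt.1 h1) (summable_pl_of_lt hc _ hz) (abs_lt.1 h1)
  · have h := ((hasDerivAt_pow (n + 1) y).const_mul (c n)).div_const (((n : ℝ) + 1) ^ (j + 1))
    refine h.congr_deriv ?_
    have hn : (n : ℝ) + 1 ≠ 0 := by positivity
    rw [Nat.add_sub_cancel]
    push_cast
    field_simp
    ring
  · have hn : (1 : ℝ) ≤ (n : ℝ) + 1 := by linarith [(Nat.cast_nonneg n : (0 : ℝ) ≤ n)]
    rw [norm_div, norm_mul, Real.norm_of_nonneg (by positivity : (0 : ℝ) ≤ ((n : ℝ) + 1) ^ j),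
      norm_pow, Real.norm_eq_abs, Real.norm_eq_abs]
    refine (div_le_self (by positivity) (one_le_pow₀ hn)).trans ?_
    have hy' : |y| ≤ ρ := (abs_lt.2 hy).le
    calc |c n| * |y| ^ n ≤ 2 * √((n : ℝ) + 1) * ρ ^ n :=
          mul_le_mul (hc n) (by gcongr) (by positivity) (by positivity)
      _ ≤ 2 * √((n : ℝ) + 1) * ((n : ℝ) + 1) * ρ ^ n :=
          mul_le_mul_of_nonneg_right (le_mul_of_one_le_right (by positivity) hn) (by positivity)

lemma hasDerivAt_pl (hc : SqrtGrowth c) (j : ℕ) {z : ℝ} (hz : |z| < 1) (hz0 : z ≠ 0) :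
    HasDerivAt (pl c (j + 1)) (pl c j z / z) z := by
  refine (hasDerivAt_pl_aux hc j hz).congr_deriv ?_
  rw [pl, ← tsum_div_const]
  refine tsum_congr fun n => ?_
  rw [pow_succ]
  field_simp

lemma pl_zero (c : ℕ → ℝ) (j : ℕ) : pl c j 0 = 0 := by simp [pl]

lemma isBigO_pl (hc : SqrtGrowth c) (j : ℕ) : pl c (j + 1) =O[𝓝 0] fun z : ℝ => z := by
  have h := (hasDerivAt_pl_aux hc j (z := 0) (by simp)).isBigO_sub
  simpa [pl_zero] using h

lemma tendsto_log_pow_mul (k : ℕ) :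
    Tendsto (fun z : ℝ => Real.log z ^ k * z) (𝓝[>] 0) (𝓝 0) := by
  have h := (Real.tendsto_pow_log_div_mul_add_atTop 1 0 k one_ne_zero).comp
    tendsto_inv_nhdsGT_zero
  have h' := h.const_mul ((-1 : ℝ) ^ k)
  rw [mul_zero] at h'
  refine h'.congr fun z => ?_
  simp only [Function.comp, Real.log_inv, one_mul, add_zero, div_inv_eq_mul]
  rw [← mul_assoc, ← mul_pow]
  simp

lemma tendsto_log_add_pow_mul (k : ℕ) (s : ℝ) :
    Tendsto (fun z : ℝ => (Real.log z + s) ^ k * z) (𝓝[>] 0) (𝓝 0) := by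
  have hw : Tendsto (fun z : ℝ => Real.exp s * z) (𝓝[>] 0) (𝓝[>] 0) := by
    refine tendsto_nhdsWithin_iff.2 ⟨?_, ?_⟩
    · have : Tendsto (fun z : ℝ => Real.exp s * z) (𝓝 0) (𝓝 (Real.exp s * 0)) :=
        (continuous_const.mul continuous_id).tendsto 0
      rw [mul_zero] at this
      exact this.mono_left nhdsWithin_le_nhds
    · filter_upwards [self_mem_nhdsWithin] with z hz
      exact mul_pos (Real.exp_pos s) hz
  have h := ((tendsto_log_pow_mul k).comp hw).const_mul (Real.exp (-s))
  rw [mul_zero] at h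
  refine h.congr' ?_
  filter_upwards [self_mem_nhdsWithin] with z hz
  have hz' : (z : ℝ) ≠ 0 := (Set.mem_Ioi.1 hz).ne'
  simp only [Function.comp]
  rw [Real.log_mul (Real.exp_ne_zero s) hz', Real.log_exp, Real.exp_neg]
  field_simp
  ring

lemma tendsto_log_add_pow_mul_pl (hc : SqrtGrowth c) (j k : ℕ) (s ε : ℝ) {z : ℝ → ℝ}
    (hz : Tendsto z (𝓝[>] 0) (𝓝[>] 0)) :
    Tendsto (fun r => (Real.log (z r) + s) ^ k * pl c (j + 1) (ε * z r)) (𝓝[>] 0) (𝓝 0) := by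
  have h1 : Tendsto (fun z : ℝ => ε * z) (𝓝[>] 0) (𝓝 0) := by
    have : Tendsto (fun z : ℝ => ε * z) (𝓝 0) (𝓝 (ε * 0)) :=
      (continuous_const.mul continuous_id).tendsto 0
    rw [mul_zero] at this
    exact this.mono_left nhdsWithin_le_nhds
  have h2 : (fun z : ℝ => pl c (j + 1) (ε * z)) =O[𝓝[>] 0] fun z : ℝ => z :=
    ((isBigO_pl hc j).comp_tendsto h1).trans (Asymptotics.isBigO_const_mul_self ε _ _)
  have h3 := (Asymptotics.isBigO_refl (fun z : ℝ => (Real.log z + s) ^ k) (𝓝[>] 0)).mul h2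
  exact (h3.trans_tendsto (tendsto_log_add_pow_mul k s)).comp hz

/-- The combination `∑_{k ≤ m} (-l)^k/k! f_{m+1-k}`, whose derivative telescopes. -/
noncomputable def chain (f : ℕ → ℝ) (l : ℝ) (m : ℕ) : ℝ :=
  ∑ k ∈ Finset.range (m + 1), (-l) ^ k / (k.factorial : ℝ) * f (m + 1 - k)

lemma hasDerivAt_chain (m : ℕ) {f : ℕ → ℝ → ℝ} {l : ℝ → ℝ} {l' x : ℝ}
    (hl : HasDerivAt l l' x)
    (hf : ∀ j ≤ m, HasDerivAt (f (j + 1)) (f j x * l') x) :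
    HasDerivAt (fun r => chain (fun j => f j r) (l r) m)
      ((-l x) ^ m / (m.factorial : ℝ) * f 0 x * l') x := by
  induction m generalizing f with
  | zero => simpa [chain] using hf 0 le_rfl
  | succ m ih =>
    have h1 := ih (f := fun j => f (j + 1)) fun j hj => hf (j + 1) (by omega)
    have h2 := (((hl.neg.pow (m + 1)).div_const ((m + 1).factorial : ℝ)).mul (hf 0 (by omega)))
    have e : (fun r => chain (fun j => f j r) (l r) (m + 1)) = fun r =>
        chain (fun j => f (j + 1) r) (l r) m
          + (-l r) ^ (m + 1) / ((m + 1).factorial : ℝ) * f (0 + 1) r := by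
      funext r
      rw [chain, Finset.sum_range_succ, chain]
      congr 1
      · refine Finset.sum_congr rfl fun k hk => ?_
        rw [Finset.mem_range] at hk
        rw [show m + 1 + 1 - k = m + 1 - k + 1 by omega]
      · simp
    rw [e]
    refine (h1.add h2).congr_deriv ?_
    have hm : ((m.factorial : ℕ) : ℝ) ≠ 0 := by positivity
    rw [Nat.factorial_succ]
    push_cast
    simp only [Pi.neg_apply, Pi.pow_apply]
    field_simp
    ring

lemma hasDerivAt_chain_pl (hc : SqrtGrowth c) (s m : ℕ) {z l : ℝ → ℝ} {z' l' x : ℝ}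
    (hz : HasDerivAt z z' x) (hl : HasDerivAt l l' x) (h1 : |z x| < 1) (h0 : z x ≠ 0)
    (hzl : z' = z x * l') :
    HasDerivAt (fun r => chain (fun j => pl c (j + s) (z r)) (l r) m)
      ((-l x) ^ m / (m.factorial : ℝ) * pl c s (z x) * l') x := by
  have h := hasDerivAt_chain m (f := fun j r => pl c (j + s) (z r)) hl fun j _ => by
    have h := (hasDerivAt_pl hc (j + s) h1 h0).comp x hz
    rw [show j + 1 + s = j + s + 1 by omega]
    refine h.congr_deriv ?_
    rw [hzl]
    field_simp
  simpa using h

lemma continuousOn_chain_pl (hc : SqrtGrowth c) {s : ℕ} (hs : 1 ≤ s) (m : ℕ) {z l : ℝ → ℝ}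
    {S : Set ℝ} (hz : ContinuousOn z S) (hl : ContinuousOn l S)
    (hS : ∀ r ∈ S, z r ∈ Set.Icc (-1 : ℝ) 1) :
    ContinuousOn (fun r => chain (fun j => pl c (j + s) (z r)) (l r) m) S := by
  refine continuousOn_finsetSum _ fun k hk => ?_
  rw [Finset.mem_range] at hk
  exact ((hl.neg.pow k).div_const _).mul
    ((continuousOn_pl hc (by omega : 2 ≤ m + 1 - k + s)).comp hz hS)

lemma tendsto_chain_pl (hc : SqrtGrowth c) {s : ℕ} (hs : 1 ≤ s) (m : ℕ) (d ε : ℝ) {z : ℝ → ℝ}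
    (hz : Tendsto z (𝓝[>] 0) (𝓝[>] 0)) :
    Tendsto (fun r => chain (fun j => pl c (j + s) (ε * z r)) (Real.log (z r) + d) m)
      (𝓝[>] 0) (𝓝 0) := by
  have h : Tendsto (fun r => ∑ k ∈ Finset.range (m + 1), (-(Real.log (z r) + d)) ^ k /
      (k.factorial : ℝ) * pl c (m + 1 - k + s) (ε * z r)) (𝓝[>] 0)
      (𝓝 (∑ k ∈ Finset.range (m + 1), (-1) ^ k / (k.factorial : ℝ) * 0)) := by
    refine tendsto_finsetSum _ fun k _ => ?_
    have h := (tendsto_log_add_pow_mul_pl hc (m + 1 - k + s - 1) k d ε hz).const_mul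
      ((-1) ^ k / (k.factorial : ℝ))
    refine h.congr fun r => ?_
    rw [show m + 1 - k + s - 1 + 1 = m + 1 - k + s by omega, neg_pow (Real.log (z r) + d)]
    ring
  simpa [chain] using h

lemma eq_of_hasDerivAt_zero_of_tendsto {f : ℝ → ℝ} {b ℓ : ℝ} (hb : 0 < b)
    (hc : ContinuousOn f (Set.Ioc 0 b)) (hd : ∀ x ∈ Set.Ioo 0 b, HasDerivAt f 0 x)
    (hl : Tendsto f (𝓝[>] 0) (𝓝 ℓ)) : f b = ℓ := by
  refine tendsto_nhds_unique (tendsto_const_nhds.congr' ?_) hl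
  filter_upwards [Ioo_mem_nhdsGT hb] with x hx
  exact constant_of_has_deriv_right_zero
    (hc.mono fun y hy => ⟨hx.1.trans_le hy.1, hy.2⟩)
    (fun y hy => (hd y ⟨hx.1.trans_le hy.1, hy.2⟩).hasDerivWithinAt) b ⟨hx.2.le, le_rfl⟩

/-- The harmonic numbers `H_n = 1 + 1/2 + ⋯ + 1/n`. -/
noncomputable def harm (n : ℕ) : ℝ := ∑ i ∈ Finset.range n, 1 / ((i : ℝ) + 1)

/-- The polylogarithm of order `j`. -/
noncomputable def li : ℕ → ℝ → ℝ := pl fun _ => 1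

/-- The series `∑ H_{n-1} zⁿ/n^j`. -/
noncomputable def nl : ℕ → ℝ → ℝ := pl harm

/-- The coefficients `(-1)^n / C(2n,n)`, shifted by one. -/
noncomputable def binomCoeff (n : ℕ) : ℝ :=
  (-1) ^ (n + 1) / (Nat.choose (2 * (n + 1)) (n + 1) : ℝ)

/-- The inverse central binomial series `∑ (-z)ⁿ/(n^j C(2n,n))`. -/
noncomputable def ql : ℕ → ℝ → ℝ := pl binomCoeff

lemma one_le_two_mul_sqrt (n : ℕ) : (1 : ℝ) ≤ 2 * √((n : ℝ) + 1) := by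
  have : (1 : ℝ) ≤ √((n : ℝ) + 1) :=
    Real.one_le_sqrt.2 (by linarith [(Nat.cast_nonneg n : (0 : ℝ) ≤ n)])
  linarith

lemma sqrtGrowth_one : SqrtGrowth fun _ => 1 := fun n => by
  simpa using one_le_two_mul_sqrt n

lemma harm_succ (n : ℕ) : harm (n + 1) = harm n + 1 / ((n : ℝ) + 1) := by
  simp [harm, Finset.sum_range_succ]

lemma harm_nonneg (n : ℕ) : 0 ≤ harm n := Finset.sum_nonneg fun i _ => by positivity

lemma harm_le_two_mul_sqrt (n : ℕ) : harm n ≤ 2 * √(n : ℝ) := by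
  induction n with
  | zero => simp [harm]
  | succ n ih =>
    rw [harm_succ]
    push_cast
    have hn : (0 : ℝ) ≤ n := Nat.cast_nonneg n
    have h1 : √(n : ℝ) ^ 2 = n := Real.sq_sqrt hn
    have h2 : √((n : ℝ) + 1) ^ 2 = n + 1 := Real.sq_sqrt (by linarith)
    have h3 : √(n : ℝ) ≤ √((n : ℝ) + 1) := Real.sqrt_le_sqrt (by linarith)
    have h4 : 1 ≤ √((n : ℝ) + 1) := Real.one_le_sqrt.2 (by linarith)
    have h5 : 1 / ((n : ℝ) + 1) ≤ 2 * (√((n : ℝ) + 1) - √(n : ℝ)) := by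
      generalize √(n : ℝ) = a at *
      generalize √((n : ℝ) + 1) = b at *
      rw [div_le_iff₀ (by linarith), ← h2]
      have h6 : 1 ≤ (b - a) * (2 * b) := by nlinarith
      nlinarith [mul_nonneg (sub_nonneg.2 h3) (mul_nonneg (by linarith : 0 ≤ b)
        (sub_nonneg.2 h4))]
    linarith

lemma sqrtGrowth_harm : SqrtGrowth harm := fun n => by
  rw [abs_of_nonneg (harm_nonneg n)]
  exact (harm_le_two_mul_sqrt n).trans (by gcongr; linarith)

lemma sqrtGrowth_binomCoeff : SqrtGrowth binomCoeff := fun n => by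
  refine le_trans ?_ (one_le_two_mul_sqrt n)
  rw [binomCoeff, abs_div, abs_pow, abs_neg, abs_one, one_pow, Nat.abs_cast]
  refine div_le_one_of_le₀ ?_ (Nat.cast_nonneg _)
  exact_mod_cast Nat.choose_pos (by omega)

lemma li_one {z : ℝ} (hz : |z| < 1) : li 1 z = -Real.log (1 - z) := by
  rw [← (Real.hasSum_pow_div_log_of_abs_lt_one hz).tsum_eq, li, pl]
  simp

lemma sum_harm_mul_pow {z : ℝ} (hz : |z| < 1) :
    (1 - z) * ∑' n : ℕ, harm n * z ^ n / ((n : ℝ) + 1) ^ 0 = -Real.log (1 - z) := by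
  have hs : Summable fun n : ℕ => harm n * z ^ n := by
    refine Summable.of_norm_bounded (summable_sqrt_mul_geometric (abs_nonneg z) hz) fun n => ?_
    rw [norm_mul, norm_pow, Real.norm_eq_abs, Real.norm_eq_abs]
    refine mul_le_mul_of_nonneg_right ((sqrtGrowth_harm n).trans ?_) (by positivity)
    exact le_mul_of_one_le_right (by positivity)
      (by linarith [(Nat.cast_nonneg n : (0 : ℝ) ≤ n)])
  have h0 : ∑' n : ℕ, harm n * z ^ n / ((n : ℝ) + 1) ^ 0 = ∑' n : ℕ, harm n * z ^ n := by simp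
  have h1 : ∑' n : ℕ, harm n * z ^ n = ∑' n : ℕ, harm (n + 1) * z ^ (n + 1) := by
    rw [hs.tsum_eq_zero_add]
    simp [harm]
  have h2 : z * ∑' n : ℕ, harm n * z ^ n = ∑' n : ℕ, harm n * z ^ (n + 1) := by
    rw [← tsum_mul_left]
    exact tsum_congr fun n => by ring
  have hs1 : Summable fun n : ℕ => harm n * z ^ (n + 1) :=
    (hs.mul_left z).congr fun n => by ring
  rw [h0, sub_mul, one_mul, h2, h1, ← ((summable_nat_add_iff 1).2 hs).tsum_sub hs1,
    ← (Real.hasSum_pow_div_log_of_abs_lt_one hz).tsum_eq]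
  refine tsum_congr fun n => ?_
  rw [harm_succ]
  ring

lemma nl_one {z : ℝ} (hz : |z| < 1) : nl 1 z = Real.log (1 - z) ^ 2 / 2 := by
  have hd : ∀ y ∈ Set.Ioo (-1 : ℝ) 1,
      HasDerivAt (fun y => nl 1 y - Real.log (1 - y) ^ 2 / 2) 0 y := fun y hy => by
    have hy1 : (1 : ℝ) - y ≠ 0 := by linarith [hy.2]
    have h1 := hasDerivAt_pl_aux sqrtGrowth_harm 0 (abs_lt.2 hy)
    have h2 := ((((hasDerivAt_id y).const_sub 1).log hy1).pow 2).div_const 2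
    refine (h1.sub h2).congr_deriv ?_
    have h3 : ∑' n : ℕ, harm n * y ^ n / ((n : ℝ) + 1) ^ 0 = -Real.log (1 - y) / (1 - y) := by
      rw [eq_div_iff hy1, mul_comm]
      exact sum_harm_mul_pow (abs_lt.2 hy)
    rw [h3]
    push_cast
    simp only [id]
    field_simp
    ring
  have h := isOpen_Ioo.is_const_of_deriv_eq_zero isPreconnected_Ioo
    (fun y hy => (hd y hy).differentiableAt.differentiableWithinAt)
    (fun y hy => (hd y hy).deriv) (abs_lt.1 hz) (by norm_num : (0 : ℝ) ∈ Set.Ioo (-1 : ℝ) 1)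
  simp [nl, pl_zero] at h
  rw [nl]
  linarith

lemma binomCoeff_succ (n : ℕ) :
    binomCoeff (n + 1) * (4 * (n : ℝ) + 6) = -binomCoeff n * ((n : ℝ) + 2) := by
  have h := Nat.succ_mul_centralBinom_succ (n + 1)
  simp only [Nat.centralBinom] at h
  have h' : ((n : ℝ) + 2) * (Nat.choose (2 * (n + 1 + 1)) (n + 1 + 1) : ℝ)
      = (4 * (n : ℝ) + 6) * (Nat.choose (2 * (n + 1)) (n + 1) : ℝ) := by
    have := congrArg (Nat.cast : ℕ → ℝ) h
    push_cast at this
    linarith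
  have p1 : (0 : ℝ) < (Nat.choose (2 * (n + 1)) (n + 1) : ℝ) := by
    exact_mod_cast Nat.choose_pos (by omega)
  have p2 : (0 : ℝ) < (Nat.choose (2 * (n + 1 + 1)) (n + 1 + 1) : ℝ) := by
    exact_mod_cast Nat.choose_pos (by omega)
  rw [binomCoeff, binomCoeff, div_mul_eq_mul_div, ← neg_div, div_mul_eq_mul_div,
    div_eq_div_iff p2.ne' p1.ne', pow_succ (-1 : ℝ) (n + 1)]
  linear_combination (-1) ^ (n + 1) * h'

lemma ql_ode {u : ℝ} (hu : |u| < 1) :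
    u * (4 + u) * ∑' n : ℕ, binomCoeff n * u ^ n / ((n : ℝ) + 1) ^ 0 = 2 * ql 1 u - u := by
  have hs1 := summable_pl_of_lt sqrtGrowth_binomCoeff 0 hu
  have hs2 := summable_pl_of_lt sqrtGrowth_binomCoeff 1 hu
  have h0 : u * ∑' n : ℕ, binomCoeff n * u ^ n / ((n : ℝ) + 1) ^ 0
      = ∑' n : ℕ, binomCoeff n * u ^ (n + 1) / ((n : ℝ) + 1) ^ 0 := by
    rw [← tsum_mul_left]
    exact tsum_congr fun n => by ring
  have hb : binomCoeff 0 = -1 / 2 := by norm_num [binomCoeff]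
  rw [mul_right_comm, h0, mul_add, ql, pl, hs2.tsum_eq_zero_add,
    add_comm (_ * 4), mul_comm _ (4 : ℝ)]
  nth_rewrite 2 [hs1.tsum_eq_zero_add]
  have k1 := ((summable_nat_add_iff 1).2 hs1).mul_left 4
  have k2 := hs1.mul_left u
  have k3 := ((summable_nat_add_iff 1).2 hs2).mul_left 2
  have key : ∑' n : ℕ, u * (binomCoeff n * u ^ (n + 1) / ((n : ℝ) + 1) ^ 0)
      + ∑' n : ℕ, 4 * (binomCoeff (n + 1) * u ^ (n + 1 + 1) / (((n + 1 : ℕ) : ℝ) + 1) ^ 0)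
      = ∑' n : ℕ, 2 * (binomCoeff (n + 1) * u ^ (n + 1 + 1) / (((n + 1 : ℕ) : ℝ) + 1) ^ 1) := by
    rw [← k2.tsum_add k1]
    refine tsum_congr fun n => ?_
    have h := binomCoeff_succ n
    have hn : (n : ℝ) + 2 ≠ 0 := by positivity
    have e : (((n + 1 : ℕ) : ℝ) + 1) = (n : ℝ) + 2 := by push_cast; ring
    rw [e, pow_zero, pow_zero, pow_one]
    field_simp
    linear_combination u ^ (n + 2) * h
  rw [tsum_mul_left, tsum_mul_left, tsum_mul_left] at key
  rw [mul_comm _ u]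
  simp only [hb] at *
  norm_num at *
  linarith

lemma tendsto_sq_div : Tendsto (fun r : ℝ => r ^ 2 / (1 - r)) (𝓝[>] 0) (𝓝[>] 0) := by
  refine tendsto_nhdsWithin_iff.2 ⟨?_, ?_⟩
  · have : ContinuousAt (fun r : ℝ => r ^ 2 / (1 - r)) 0 := by
      refine ContinuousAt.div (by fun_prop) (by fun_prop) (by norm_num)
    have h := this.tendsto
    norm_num at h
    exact h.mono_left nhdsWithin_le_nhds
  · filter_upwards [Ioo_mem_nhdsGT one_pos] with r hr
    exact div_pos (pow_pos hr.1 2) (by linarith [hr.2])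

lemma tendsto_div_one_sub : Tendsto (fun r : ℝ => r / (1 - r)) (𝓝[>] 0) (𝓝[>] 0) := by
  refine tendsto_nhdsWithin_iff.2 ⟨?_, ?_⟩
  · have : ContinuousAt (fun r : ℝ => r / (1 - r)) 0 := by
      refine ContinuousAt.div (by fun_prop) (by fun_prop) (by norm_num)
    have h := this.tendsto
    norm_num at h
    exact h.mono_left nhdsWithin_le_nhds
  · filter_upwards [Ioo_mem_nhdsGT one_pos] with r hr
    exact div_pos hr.1 (by linarith [hr.2])

lemma hasDerivAt_sq_div {r : ℝ} (h0 : 0 < r) (h1 : r < 1) :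
    HasDerivAt (fun r : ℝ => r ^ 2 / (1 - r))
      (r ^ 2 / (1 - r) * (2 / r + 1 / (1 - r))) r := by
  have h : (1 : ℝ) - r ≠ 0 := by linarith
  refine ((hasDerivAt_pow 2 r).div ((hasDerivAt_id r).const_sub 1) h).congr_deriv ?_
  simp only [id]
  field_simp
  ring

lemma hasDerivAt_div_one_sub {r : ℝ} (h0 : 0 < r) (h1 : r < 1) :
    HasDerivAt (fun r : ℝ => r / (1 - r)) (r / (1 - r) * (1 / r + 1 / (1 - r))) r := by
  have h : (1 : ℝ) - r ≠ 0 := by linarith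
  refine ((hasDerivAt_id r).div ((hasDerivAt_id r).const_sub 1) h).congr_deriv ?_
  simp only [id]
  field_simp
  ring

lemma hasDerivAt_log_one_sub {r : ℝ} (h1 : r < 1) :
    HasDerivAt (fun r : ℝ => Real.log (1 - r)) (-(1 / (1 - r))) r := by
  have h : (1 : ℝ) - r ≠ 0 := by linarith
  refine (((hasDerivAt_id r).const_sub 1).log h).congr_deriv ?_
  simp only [id]
  ring

lemma tendsto_log_one_sub : Tendsto (fun r : ℝ => Real.log (1 - r)) (𝓝[>] 0) (𝓝 0) := by
  have h := (hasDerivAt_log_one_sub (r := 0) one_pos).continuousAt.tendsto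
  norm_num at h
  exact h.mono_left nhdsWithin_le_nhds

lemma sq_div_bounds {r : ℝ} (h0 : 0 < r) (h1 : r ≤ 1 / 2) :
    0 < r ^ 2 / (1 - r) ∧ r ^ 2 / (1 - r) ≤ 1 / 2 := by
  have h : 0 < 1 - r := by linarith
  refine ⟨by positivity, ?_⟩
  rw [div_le_iff₀ h]
  nlinarith

lemma div_one_sub_bounds {r : ℝ} (h0 : 0 < r) (h1 : r ≤ 1 / 2) :
    0 < r / (1 - r) ∧ r / (1 - r) ≤ 1 := by
  have h : 0 < 1 - r := by linarith
  refine ⟨by positivity, ?_⟩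
  rw [div_le_iff₀ h]
  linarith

lemma ql_one {r : ℝ} (h0 : 0 < r) (h1 : r ≤ 1 / 2) :
    (2 - r) / r * ql 1 (r ^ 2 / (1 - r)) - Real.log (1 - r) = 0 := by
  have hd : ∀ x : ℝ, 0 < x → x ≤ 1 / 2 →
      HasDerivAt (fun r => (2 - r) / r * ql 1 (r ^ 2 / (1 - r)) - Real.log (1 - r)) 0 x := by
    intro x hx0 hx1
    have hx2 : (1 : ℝ) - x ≠ 0 := by linarith
    have hx3 : (2 : ℝ) - x ≠ 0 := by linarith
    have hb := sq_div_bounds hx0 hx1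
    have hu : |x ^ 2 / (1 - x)| < 1 := by
      rw [abs_of_pos hb.1]; linarith [hb.2]
    have d1 := (hasDerivAt_pl_aux sqrtGrowth_binomCoeff 0 hu).comp x
      (hasDerivAt_sq_div hx0 (by linarith))
    have d2 : HasDerivAt (fun r : ℝ => (2 - r) / r) (((-1) * x - (2 - x) * 1) / x ^ 2) x :=
      ((hasDerivAt_id x).const_sub 2).div (hasDerivAt_id x) hx0.ne'
    refine ((d2.mul d1).sub (hasDerivAt_log_one_sub (by linarith))).congr_deriv ?_
    have ho := ql_ode hu
    simp only [Function.comp, zero_add] at *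
    rw [ql] at ho
    set S := ∑' n : ℕ, binomCoeff n * (x ^ 2 / (1 - x)) ^ n / ((n : ℝ) + 1) ^ 0
    set Y := pl binomCoeff 1 (x ^ 2 / (1 - x))
    have ho' : S = (2 * Y - x ^ 2 / (1 - x)) * (1 - x) ^ 2 / (x ^ 2 * (2 - x) ^ 2) := by
      rw [eq_div_iff (by positivity), ← ho]
      field_simp
      ring
    rw [ho']
    field_simp
    ring
  refine eq_of_hasDerivAt_zero_of_tendsto
    (f := fun r => (2 - r) / r * ql 1 (r ^ 2 / (1 - r)) - Real.log (1 - r)) h0 (fun x hx =>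
    (hd x hx.1 (hx.2.trans h1)).continuousAt.continuousWithinAt)
    (fun x hx => hd x hx.1 (hx.2.le.trans h1)) ?_
  have hO : (fun r : ℝ => ql 1 (r ^ 2 / (1 - r))) =O[𝓝[>] 0] fun r : ℝ => r ^ 2 / (1 - r) :=
    (isBigO_pl sqrtGrowth_binomCoeff 0).comp_tendsto
      (tendsto_sq_div.mono_right nhdsWithin_le_nhds)
  have h2 := (Asymptotics.isBigO_refl (fun r : ℝ => (2 - r) / r) (𝓝[>] 0)).mul hO
  have h3 : Tendsto (fun r : ℝ => (2 - r) / r * (r ^ 2 / (1 - r))) (𝓝[>] 0) (𝓝 0) := by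
    have : ContinuousAt (fun r : ℝ => (2 - r) * r / (1 - r)) 0 := by
      refine ContinuousAt.div (by fun_prop) (by fun_prop) (by norm_num)
    have h := this.tendsto
    norm_num at h
    refine (h.mono_left nhdsWithin_le_nhds).congr' ?_
    filter_upwards [self_mem_nhdsWithin] with r hr
    have : (r : ℝ) ≠ 0 := (Set.mem_Ioi.1 hr).ne'
    field_simp
  simpa using (h2.trans_tendsto h3).sub tendsto_log_one_sub

lemma ql_two {r : ℝ} (h0 : 0 < r) (h1 : r ≤ 1 / 2) :
    ql 2 (r ^ 2 / (1 - r)) = -(Real.log (1 - r) ^ 2 / 2) := by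
  have hd : ∀ x : ℝ, 0 < x → x ≤ 1 / 2 →
      HasDerivAt (fun r => ql 2 (r ^ 2 / (1 - r)) + Real.log (1 - r) ^ 2 / 2) 0 x := by
    intro x hx0 hx1
    have hx2 : (1 : ℝ) - x ≠ 0 := by linarith
    have hx3 : (2 : ℝ) - x ≠ 0 := by linarith
    have hb := sq_div_bounds hx0 hx1
    have hu : |x ^ 2 / (1 - x)| < 1 := by
      rw [abs_of_pos hb.1]; linarith [hb.2]
    have d1 := (hasDerivAt_pl sqrtGrowth_binomCoeff 1 hu hb.1.ne').comp x
      (hasDerivAt_sq_div hx0 (by linarith))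
    have d2 := ((hasDerivAt_log_one_sub (by linarith : x < 1)).pow 2).div_const 2
    refine (d1.add d2).congr_deriv ?_
    have ho := ql_one hx0 hx1
    rw [ql] at ho
    set Y := pl binomCoeff 1 (x ^ 2 / (1 - x))
    have e : Real.log (1 - x) = (2 - x) / x * Y := by linarith
    push_cast
    rw [e]
    field_simp
    ring
  have h := eq_of_hasDerivAt_zero_of_tendsto (ℓ := 0) h0 (fun x hx =>
    (hd x hx.1 (hx.2.trans h1)).continuousAt.continuousWithinAt)
    (fun x hx => hd x hx.1 (hx.2.le.trans h1)) ?_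
  · linarith
  have h2 := tendsto_log_add_pow_mul_pl sqrtGrowth_binomCoeff 1 0 0 1 tendsto_sq_div
  simpa [ql] using h2.add ((tendsto_log_one_sub.pow 2).div_const 2)

lemma log_div_one_sub {r : ℝ} (h0 : 0 < r) (h1 : r < 1) :
    Real.log (r / (1 - r)) = Real.log r - Real.log (1 - r) :=
  Real.log_div h0.ne' (by linarith)

lemma log_sq_div {r : ℝ} (h0 : 0 < r) (h1 : r < 1) :
    Real.log (r ^ 2 / (1 - r)) = 2 * Real.log r - Real.log (1 - r) := by
  rw [Real.log_div (by positivity) (by linarith), Real.log_pow]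
  push_cast
  rfl

lemma one_add_div_one_sub {r : ℝ} (h1 : r < 1) : 1 - -1 * (r / (1 - r)) = (1 - r)⁻¹ := by
  have : (1 : ℝ) - r ≠ 0 := by linarith
  field_simp
  ring

lemma abs_neg_div_one_sub_lt {r : ℝ} (h0 : 0 < r) (h1 : r < 1 / 2) :
    |-1 * (r / (1 - r))| < 1 := by
  have h : 0 < 1 - r := by linarith
  rw [neg_one_mul, abs_neg, abs_of_pos (by positivity), div_lt_one h]
  linarith

lemma li_one_neg_div {r : ℝ} (h0 : 0 < r) (h1 : r < 1 / 2) :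
    li 1 (-1 * (r / (1 - r))) = Real.log (1 - r) := by
  rw [li_one (abs_neg_div_one_sub_lt h0 h1), one_add_div_one_sub (by linarith), Real.log_inv,
    neg_neg]

lemma nl_one_neg_div {r : ℝ} (h0 : 0 < r) (h1 : r < 1 / 2) :
    nl 1 (-1 * (r / (1 - r))) = Real.log (1 - r) ^ 2 / 2 := by
  rw [nl_one (abs_neg_div_one_sub_lt h0 h1), one_add_div_one_sub (by linarith), Real.log_inv,
    neg_sq]

lemma hasDerivAt_log_div_one_sub (d : ℝ) {r : ℝ} (h0 : 0 < r) (h1 : r < 1) :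
    HasDerivAt (fun r : ℝ => Real.log (r / (1 - r)) + d) (1 / r + 1 / (1 - r)) r := by
  have h : (0 : ℝ) < 1 - r := by linarith
  refine (((hasDerivAt_div_one_sub h0 h1).log (by positivity)).add_const d).congr_deriv ?_
  field_simp

lemma hasDerivAt_log_sq_div (d : ℝ) {r : ℝ} (h0 : 0 < r) (h1 : r < 1) :
    HasDerivAt (fun r : ℝ => Real.log (r ^ 2 / (1 - r)) + d) (2 / r + 1 / (1 - r)) r := by
  have h : (0 : ℝ) < 1 - r := by linarith
  refine (((hasDerivAt_sq_div h0 h1).log (by positivity)).add_const d).congr_deriv ?_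
  field_simp

lemma hasDerivAt_log_add (d : ℝ) {r : ℝ} (h0 : 0 < r) :
    HasDerivAt (fun r : ℝ => Real.log r + d) (1 / r) r := by
  simpa using (Real.hasDerivAt_log h0.ne').add_const d

lemma hasDerivAt_chain_neg_div (hc : SqrtGrowth c) (s m : ℕ) (d : ℝ) {r : ℝ} (h0 : 0 < r)
    (h1 : r < 1 / 2) :
    HasDerivAt (fun r => chain (fun j => pl c (j + s) (-1 * (r / (1 - r))))
        (Real.log (r / (1 - r)) + d) m)
      ((-(Real.log (r / (1 - r)) + d)) ^ m / (m.factorial : ℝ) * pl c s (-1 * (r / (1 - r)))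
        * (1 / r + 1 / (1 - r))) r := by
  have h := (div_one_sub_bounds h0 h1.le).1
  refine hasDerivAt_chain_pl hc s m
    ((hasDerivAt_div_one_sub h0 (by linarith)).const_mul (-1))
    (hasDerivAt_log_div_one_sub d h0 (by linarith)) (abs_neg_div_one_sub_lt h0 h1)
    (by linarith) (by ring)

lemma hasDerivAt_chain_sq_div (hc : SqrtGrowth c) (s m : ℕ) (d : ℝ) {r : ℝ} (h0 : 0 < r)
    (h1 : r < 1 / 2) :
    HasDerivAt (fun r => chain (fun j => pl c (j + s) (1 * (r ^ 2 / (1 - r))))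
        (Real.log (r ^ 2 / (1 - r)) + d) m)
      ((-(Real.log (r ^ 2 / (1 - r)) + d)) ^ m / (m.factorial : ℝ)
        * pl c s (1 * (r ^ 2 / (1 - r))) * (2 / r + 1 / (1 - r))) r := by
  have h := sq_div_bounds h0 h1.le
  refine hasDerivAt_chain_pl hc s m ((hasDerivAt_sq_div h0 (by linarith)).const_mul 1)
    (hasDerivAt_log_sq_div d h0 (by linarith)) ?_ (by linarith) (by ring)
  rw [one_mul, abs_of_pos h.1]
  linarith

lemma hasDerivAt_chain_id (hc : SqrtGrowth c) (s m : ℕ) (d : ℝ) {r : ℝ} (h0 : 0 < r)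
    (h1 : r < 1) :
    HasDerivAt (fun r => chain (fun j => pl c (j + s) (1 * r)) (Real.log r + d) m)
      ((-(Real.log r + d)) ^ m / (m.factorial : ℝ) * pl c s (1 * r) * (1 / r)) r := by
  refine hasDerivAt_chain_pl hc s m ((hasDerivAt_id r).const_mul 1)
    (hasDerivAt_log_add d h0) ?_ (by simpa using h0.ne') ?_
  · rw [one_mul, abs_of_pos h0]
    exact h1
  · field_simp

lemma hasDerivAt_chain_one_sub (hc : SqrtGrowth c) (s m : ℕ) {r : ℝ} (h0 : 0 < r) (h1 : r < 1) :
    HasDerivAt (fun r => chain (fun j => pl c (j + s) (1 - r)) (Real.log (1 - r)) m)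
      ((-Real.log (1 - r)) ^ m / (m.factorial : ℝ) * pl c s (1 - r) * (-(1 / (1 - r)))) r := by
  have h : (0 : ℝ) < 1 - r := by linarith
  refine hasDerivAt_chain_pl hc s m ((hasDerivAt_id r).const_sub 1)
    (hasDerivAt_log_one_sub h1) ?_ (by simpa using h.ne') ?_
  · rw [abs_of_pos h]
    linarith
  · field_simp

lemma continuousOn_chain_neg_div (hc : SqrtGrowth c) {s : ℕ} (hs : 1 ≤ s) (m : ℕ) (d : ℝ) :
    ContinuousOn (fun r => chain (fun j => pl c (j + s) (-1 * (r / (1 - r))))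
        (Real.log (r / (1 - r)) + d) m) (Set.Ioc 0 (1 / 2)) := by
  refine continuousOn_chain_pl hc hs m (fun r hr => ?_) (fun r hr => ?_) (fun r hr => ?_)
  · exact ((hasDerivAt_div_one_sub hr.1 (by linarith [hr.2])).const_mul
      (-1)).continuousAt.continuousWithinAt
  · exact (hasDerivAt_log_div_one_sub d hr.1
      (by linarith [hr.2])).continuousAt.continuousWithinAt
  · have h := div_one_sub_bounds hr.1 hr.2
    constructor <;> linarith

lemma continuousOn_chain_sq_div (hc : SqrtGrowth c) {s : ℕ} (hs : 1 ≤ s) (m : ℕ) (d : ℝ) :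
    ContinuousOn (fun r => chain (fun j => pl c (j + s) (1 * (r ^ 2 / (1 - r))))
        (Real.log (r ^ 2 / (1 - r)) + d) m) (Set.Ioc 0 (1 / 2)) := by
  refine continuousOn_chain_pl hc hs m (fun r hr => ?_) (fun r hr => ?_) (fun r hr => ?_)
  · exact ((hasDerivAt_sq_div hr.1 (by linarith [hr.2])).const_mul
      1).continuousAt.continuousWithinAt
  · exact (hasDerivAt_log_sq_div d hr.1
      (by linarith [hr.2])).continuousAt.continuousWithinAt
  · have h := sq_div_bounds hr.1 hr.2
    constructor <;> linarith

lemma continuousOn_chain_id (hc : SqrtGrowth c) {s : ℕ} (hs : 1 ≤ s) (m : ℕ) (d : ℝ) :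
    ContinuousOn (fun r => chain (fun j => pl c (j + s) (1 * r)) (Real.log r + d) m)
      (Set.Ioc 0 (1 / 2)) := by
  refine continuousOn_chain_pl hc hs m (by fun_prop) (fun r hr => ?_) (fun r hr => ?_)
  · exact (hasDerivAt_log_add d hr.1).continuousAt.continuousWithinAt
  · constructor <;> linarith [hr.1, hr.2]

lemma continuousOn_chain_one_sub (hc : SqrtGrowth c) {s : ℕ} (hs : 1 ≤ s) (m : ℕ) :
    ContinuousOn (fun r => chain (fun j => pl c (j + s) (1 - r)) (Real.log (1 - r)) m)
      (Set.Icc 0 (1 / 2)) := by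
  refine continuousOn_chain_pl hc hs m (by fun_prop) (fun r hr => ?_) (fun r hr => ?_)
  · exact (hasDerivAt_log_one_sub (by linarith [hr.2])).continuousAt.continuousWithinAt
  · constructor <;> linarith [hr.1, hr.2]

lemma tendsto_chain_one_sub (hc : SqrtGrowth c) {s : ℕ} (hs : 1 ≤ s) (m : ℕ) :
    Tendsto (fun r => chain (fun j => pl c (j + s) (1 - r)) (Real.log (1 - r)) m)
      (𝓝[>] 0) (𝓝 (pl c (m + 1 + s) 1)) := by
  have h := (continuousOn_chain_one_sub hc hs m) 0 (by norm_num)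
  have e : chain (fun j => pl c (j + s) (1 - 0)) (Real.log (1 - 0)) m = pl c (m + 1 + s) 1 := by
    rw [sub_zero, Real.log_one, neg_zero.symm, chain, Finset.sum_range_succ']
    simp
  rw [ContinuousWithinAt, e] at h
  refine h.mono_left ?_
  rw [← nhdsWithin_Ioo_eq_nhdsGT (by norm_num : (0 : ℝ) < 1 / 2)]
  exact nhdsWithin_mono _ Set.Ioo_subset_Icc_self

lemma tendsto_log_div_pow_mul_log (k : ℕ) (d : ℝ) :
    Tendsto (fun r : ℝ => (Real.log (r / (1 - r)) + d) ^ k * Real.log (1 - r))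
      (𝓝[>] 0) (𝓝 0) := by
  refine (tendsto_log_add_pow_mul_pl sqrtGrowth_one 0 k d (-1) tendsto_div_one_sub).congr' ?_
  filter_upwards [Ioo_mem_nhdsGT (by norm_num : (0 : ℝ) < 1 / 2)] with r hr
  rw [← li_one_neg_div hr.1 hr.2, li]

lemma tendsto_log_pow_mul_log_one_sub (k : ℕ) (d : ℝ) :
    Tendsto (fun r : ℝ => (Real.log r + d) ^ k * Real.log (1 - r)) (𝓝[>] 0) (𝓝 0) := by
  have h := (tendsto_log_add_pow_mul_pl sqrtGrowth_one 0 k d 1 tendsto_id).neg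
  rw [neg_zero] at h
  refine h.congr' ?_
  filter_upwards [Ioo_mem_nhdsGT one_pos] with r hr
  have e := li_one (z := r) (by rw [abs_of_pos hr.1]; exact hr.2)
  rw [li] at e
  simp only [id, one_mul, zero_add, e]
  ring

lemma tendsto_log_sq_div_pow_mul (k : ℕ) (d : ℝ) :
    Tendsto (fun r : ℝ => (Real.log (r ^ 2 / (1 - r)) + d) ^ k * Real.log (1 - r) ^ 2)
      (𝓝[>] 0) (𝓝 0) := by
  have h := (tendsto_log_add_pow_mul_pl sqrtGrowth_binomCoeff 1 k d 1 tendsto_sq_div).const_mul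
    (-2)
  rw [mul_zero] at h
  refine h.congr' ?_
  filter_upwards [Ioo_mem_nhdsGT (by norm_num : (0 : ℝ) < 1 / 2)] with r hr
  have e := ql_two hr.1 hr.2.le
  rw [ql] at e
  simp only [one_mul, Nat.reduceAdd, e]
  ring

lemma li_one_self {r : ℝ} (h0 : 0 < r) (h1 : r < 1) : li 1 (1 * r) = -Real.log (1 - r) := by
  rw [one_mul, li_one (by rwa [abs_of_pos h0])]

lemma nl_one_self {r : ℝ} (h0 : 0 < r) (h1 : r < 1) : nl 1 (1 * r) = Real.log (1 - r) ^ 2 / 2 := by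
  rw [one_mul, nl_one (by rwa [abs_of_pos h0])]

lemma li_one_one_sub {r : ℝ} (h0 : 0 < r) (h1 : r < 1) : li 1 (1 - r) = -Real.log r := by
  rw [li_one (by rw [abs_of_pos (by linarith)]; linarith), sub_sub_cancel]

lemma nl_one_one_sub {r : ℝ} (h0 : 0 < r) (h1 : r < 1) : nl 1 (1 - r) = Real.log r ^ 2 / 2 := by
  rw [nl_one (by rw [abs_of_pos (by linarith)]; linarith), sub_sub_cancel]

/-- The terms of the main identity containing the double series `nl` and `ql`. -/
noncomputable def doublePart (r : ℝ) : ℝ :=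
  12 * chain (fun j => nl (j + 1) (-1 * (r / (1 - r)))) (Real.log (r / (1 - r)) + 0) 3
  - 6 * chain (fun j => ql (j + 2) (1 * (r ^ 2 / (1 - r))))
      (Real.log (r ^ 2 / (1 - r)) + Real.log 2) 3
  + 12 * chain (fun j => nl (j + 1) (1 * r)) (Real.log r + 0) 3
  - 12 * chain (fun j => nl (j + 1) (1 - r)) (Real.log (1 - r)) 3

/-- The terms of the main identity containing polylogarithms. -/
noncomputable def polylogPart (r : ℝ) : ℝ :=
  24 * chain (fun j => li (j + 1) (-1 * (r / (1 - r)))) (Real.log (r / (1 - r)) + 0) 4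
  + 96 * chain (fun j => li (j + 1) (-1 * (r / (1 - r))))
      (Real.log (r / (1 - r)) + Real.log 2 / 2) 4
  + 24 * chain (fun j => li (j + 1) (1 * r)) (Real.log r + 0) 4
  + 96 * chain (fun j => li (j + 1) (1 * r)) (Real.log r + Real.log 2 / 2) 4
  - 24 * chain (fun j => li (j + 1) (1 - r)) (Real.log (1 - r)) 4
  - 12 * Real.log 2 * chain (fun j => li (j + 1) (1 - r)) (Real.log (1 - r)) 3

/-- The terms of the main identity that are polynomial in logarithms. -/
noncomputable def logPart (r : ℝ) : ℝ :=
  Real.log (1 - r) ^ 2 * (Real.log (r / (1 - r)) + 0) ^ 4 / 4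
  + Real.log (1 - r) ^ 2 * (Real.log (r ^ 2 / (1 - r)) + Real.log 2) ^ 4 / 8
  + Real.log (1 - r) ^ 2 * (Real.log r + 0) ^ 4 / 4
  + (Real.log (r / (1 - r)) + 0) ^ 5 * Real.log (1 - r) / 5
  + 4 * (Real.log (r / (1 - r)) + Real.log 2 / 2) ^ 5 * Real.log (1 - r) / 5
  - (Real.log r + 0) ^ 5 * Real.log (1 - r) / 5
  - 4 * (Real.log r + Real.log 2 / 2) ^ 5 * Real.log (1 - r) / 5
  + Real.log (1 - r) ^ 6 / 24 - Real.log 2 * Real.log (1 - r) ^ 5 / 5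
  + Real.log 2 ^ 2 * Real.log (1 - r) ^ 4 / 8

lemma hasDerivAt_main {r : ℝ} (h0 : 0 < r) (h1 : r < 1 / 2) :
    HasDerivAt (fun r => doublePart r - polylogPart r + logPart r) 0 r := by
  have h1' : r < 1 := by linarith
  have a := hasDerivAt_log_one_sub h1'
  have T := hasDerivAt_log_div_one_sub 0 h0 h1'
  have TT := hasDerivAt_log_div_one_sub (Real.log 2 / 2) h0 h1'
  have U := hasDerivAt_log_sq_div (Real.log 2) h0 h1'
  have b := hasDerivAt_log_add 0 h0
  have bb := hasDerivAt_log_add (Real.log 2 / 2) h0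
  have dD := (((((hasDerivAt_chain_neg_div sqrtGrowth_harm 1 3 0 h0 h1).const_mul 12).fun_sub
    ((hasDerivAt_chain_sq_div sqrtGrowth_binomCoeff 2 3 (Real.log 2) h0 h1).const_mul 6)).fun_add
    ((hasDerivAt_chain_id sqrtGrowth_harm 1 3 0 h0 h1').const_mul 12)).fun_sub
    ((hasDerivAt_chain_one_sub sqrtGrowth_harm 1 3 h0 h1').const_mul 12))
  have dP := ((((((hasDerivAt_chain_neg_div sqrtGrowth_one 1 4 0 h0 h1).const_mul 24).fun_add
    ((hasDerivAt_chain_neg_div sqrtGrowth_one 1 4 (Real.log 2 / 2) h0 h1).const_mul 96)).fun_add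
    ((hasDerivAt_chain_id sqrtGrowth_one 1 4 0 h0 h1').const_mul 24)).fun_add
    ((hasDerivAt_chain_id sqrtGrowth_one 1 4 (Real.log 2 / 2) h0 h1').const_mul 96)).fun_sub
    ((hasDerivAt_chain_one_sub sqrtGrowth_one 1 4 h0 h1').const_mul 24)).fun_sub
    ((hasDerivAt_chain_one_sub sqrtGrowth_one 1 3 h0 h1').const_mul (12 * Real.log 2))
  have dL := (((((((((((a.fun_pow 2).fun_mul (T.fun_pow 4)).div_const 4).fun_add
    (((a.fun_pow 2).fun_mul (U.fun_pow 4)).div_const 8)).fun_add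
    (((a.fun_pow 2).fun_mul (b.fun_pow 4)).div_const 4)).fun_add
    (((T.fun_pow 5).fun_mul a).div_const 5)).fun_add
    ((((TT.fun_pow 5).const_mul 4).fun_mul a).div_const 5)).fun_sub
    (((b.fun_pow 5).fun_mul a).div_const 5)).fun_sub
    ((((bb.fun_pow 5).const_mul 4).fun_mul a).div_const 5)).fun_add
    ((a.fun_pow 6).div_const 24)).fun_sub
    (((a.fun_pow 5).const_mul (Real.log 2)).div_const 5)).fun_add
    (((a.fun_pow 4).const_mul (Real.log 2 ^ 2)).div_const 8)
  refine ((dD.fun_sub dP).fun_add dL).congr_deriv ?_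
  have e1 := nl_one_neg_div h0 h1
  have e2 := ql_two h0 h1.le
  have e3 := nl_one_self h0 h1'
  have e4 := nl_one_one_sub h0 h1'
  have e5 := li_one_neg_div h0 h1
  have e6 := li_one_self h0 h1'
  have e7 := li_one_one_sub h0 h1'
  rw [nl] at e1 e3 e4
  rw [← one_mul (r ^ 2 / (1 - r)), ql] at e2
  rw [li] at e5 e6 e7
  rw [e1, e2, e3, e4, e5, e6, e7, log_div_one_sub h0 h1', log_sq_div h0 h1']
  have hr : (1 : ℝ) - r ≠ 0 := by linarith
  simp only [Nat.factorial]
  push_cast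
  field_simp
  ring

lemma continuousOn_main :
    ContinuousOn (fun r => doublePart r - polylogPart r + logPart r) (Set.Ioc 0 (1 / 2)) := by
  have a : ContinuousOn (fun r : ℝ => Real.log (1 - r)) (Set.Ioc 0 (1 / 2)) := fun r hr =>
    (hasDerivAt_log_one_sub (by linarith [hr.2])).continuousAt.continuousWithinAt
  have T (d : ℝ) : ContinuousOn (fun r : ℝ => Real.log (r / (1 - r)) + d) (Set.Ioc 0 (1 / 2)) :=
    fun r hr => (hasDerivAt_log_div_one_sub d hr.1
      (by linarith [hr.2])).continuousAt.continuousWithinAt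
  have U : ContinuousOn (fun r : ℝ => Real.log (r ^ 2 / (1 - r)) + Real.log 2)
      (Set.Ioc 0 (1 / 2)) := fun r hr => (hasDerivAt_log_sq_div (Real.log 2) hr.1
      (by linarith [hr.2])).continuousAt.continuousWithinAt
  have b (d : ℝ) : ContinuousOn (fun r : ℝ => Real.log r + d) (Set.Ioc 0 (1 / 2)) :=
    fun r hr => (hasDerivAt_log_add d hr.1).continuousAt.continuousWithinAt
  have hI : Set.Ioc (0 : ℝ) (1 / 2) ⊆ Set.Icc 0 (1 / 2) := Set.Ioc_subset_Icc_self
  have T0 := T 0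
  have T1 := T (Real.log 2 / 2)
  have b0 := b 0
  have b1 := b (Real.log 2 / 2)
  refine ((ContinuousOn.sub (ContinuousOn.add (ContinuousOn.sub ?_ ?_) ?_) ?_).sub
    (ContinuousOn.sub (ContinuousOn.sub (ContinuousOn.add (ContinuousOn.add
      (ContinuousOn.add ?_ ?_) ?_) ?_) ?_) ?_)).add (by unfold logPart; fun_prop)
  · exact continuousOn_const.mul (continuousOn_chain_neg_div sqrtGrowth_harm le_rfl 3 0)
  · exact continuousOn_const.mul (continuousOn_chain_sq_div sqrtGrowth_binomCoeff one_le_two 3 _)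
  · exact continuousOn_const.mul (continuousOn_chain_id sqrtGrowth_harm le_rfl 3 0)
  · exact continuousOn_const.mul ((continuousOn_chain_one_sub sqrtGrowth_harm le_rfl 3).mono hI)
  · exact continuousOn_const.mul (continuousOn_chain_neg_div sqrtGrowth_one le_rfl 4 0)
  · exact continuousOn_const.mul (continuousOn_chain_neg_div sqrtGrowth_one le_rfl 4 _)
  · exact continuousOn_const.mul (continuousOn_chain_id sqrtGrowth_one le_rfl 4 0)
  · exact continuousOn_const.mul (continuousOn_chain_id sqrtGrowth_one le_rfl 4 _)
  · exact continuousOn_const.mul ((continuousOn_chain_one_sub sqrtGrowth_one le_rfl 4).mono hI)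
  · exact continuousOn_const.mul ((continuousOn_chain_one_sub sqrtGrowth_one le_rfl 3).mono hI)

lemma tendsto_main :
    Tendsto (fun r => doublePart r - polylogPart r + logPart r) (𝓝[>] 0)
      (𝓝 (24 * li 6 1 + 12 * Real.log 2 * li 5 1 - 12 * nl 5 1)) := by
  have hid : Tendsto (fun r : ℝ => r) (𝓝[>] 0) (𝓝[>] 0) := tendsto_id
  have a := tendsto_log_one_sub
  have dD := (((((tendsto_chain_pl sqrtGrowth_harm le_rfl 3 0 (-1)
      tendsto_div_one_sub).const_mul 12).sub
    ((tendsto_chain_pl sqrtGrowth_binomCoeff one_le_two 3 (Real.log 2) 1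
      tendsto_sq_div).const_mul 6)).add
    ((tendsto_chain_pl sqrtGrowth_harm le_rfl 3 0 1 hid).const_mul 12)).sub
    ((tendsto_chain_one_sub sqrtGrowth_harm le_rfl 3).const_mul 12))
  have dP := ((((((tendsto_chain_pl sqrtGrowth_one le_rfl 4 0 (-1)
      tendsto_div_one_sub).const_mul 24).add
    ((tendsto_chain_pl sqrtGrowth_one le_rfl 4 (Real.log 2 / 2) (-1)
      tendsto_div_one_sub).const_mul 96)).add
    ((tendsto_chain_pl sqrtGrowth_one le_rfl 4 0 1 hid).const_mul 24)).add
    ((tendsto_chain_pl sqrtGrowth_one le_rfl 4 (Real.log 2 / 2) 1 hid).const_mul 96)).sub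
    ((tendsto_chain_one_sub sqrtGrowth_one le_rfl 4).const_mul 24)).sub
    ((tendsto_chain_one_sub sqrtGrowth_one le_rfl 3).const_mul (12 * Real.log 2))
  have dL : Tendsto logPart (𝓝[>] 0) (𝓝 0) := by
    have h := (((((((((((tendsto_log_div_pow_mul_log 4 0).mul a).div_const 4).add
      ((tendsto_log_sq_div_pow_mul 4 (Real.log 2)).div_const 8)).add
      (((tendsto_log_pow_mul_log_one_sub 4 0).mul a).div_const 4)).add
      ((tendsto_log_div_pow_mul_log 5 0).div_const 5)).add
      (((tendsto_log_div_pow_mul_log 5 (Real.log 2 / 2)).const_mul 4).div_const 5)).sub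
      ((tendsto_log_pow_mul_log_one_sub 5 0).div_const 5)).sub
      (((tendsto_log_pow_mul_log_one_sub 5 (Real.log 2 / 2)).const_mul 4).div_const 5)).add
      ((a.pow 6).div_const 24)).sub
      (((a.pow 5).const_mul (Real.log 2)).div_const 5)).add
      (((a.pow 4).const_mul (Real.log 2 ^ 2)).div_const 8)
    norm_num at h
    refine h.congr fun r => ?_
    rw [logPart]
    ring
  have h := (dD.sub dP).add dL
  refine (h.congr fun r => rfl).trans_eq ?_
  congr 1
  simp only [li, nl, Nat.reduceAdd]
  ring

lemma main_half :
    doublePart (1 / 2) - polylogPart (1 / 2) + logPart (1 / 2)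
      = 24 * li 6 1 + 12 * Real.log 2 * li 5 1 - 12 * nl 5 1 :=
  eq_of_hasDerivAt_zero_of_tendsto (f := fun r => doublePart r - polylogPart r + logPart r)
    (by norm_num) continuousOn_main (fun _ hr => hasDerivAt_main hr.1 hr.2) tendsto_main

lemma log_half : Real.log (1 / 2) = -Real.log 2 := by rw [one_div, Real.log_inv]

lemma main_half_expanded :
    12 * nl 5 (-1) - 6 * ql 6 (1 / 2)
      - (120 * li 6 (-1) - 48 * Real.log 2 * li 5 (-1) + 12 * Real.log 2 ^ 2 * li 4 (-1)
        - 2 * Real.log 2 ^ 3 * li 3 (-1) + Real.log 2 ^ 4 / 4 * li 2 (-1)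
        + 96 * li 6 (1 / 2) + 36 * Real.log 2 * li 5 (1 / 2)
        - 4 * Real.log 2 ^ 3 * li 3 (1 / 2) - 7 / 4 * Real.log 2 ^ 4 * li 2 (1 / 2))
      + 11 / 30 * Real.log 2 ^ 6
      = 24 * li 6 1 + 12 * Real.log 2 * li 5 1 - 12 * nl 5 1 := by
  rw [← main_half, doublePart, polylogPart, logPart]
  have e1 : (1 : ℝ) - 1 / 2 = 1 / 2 := by norm_num
  have e2 : (1 / 2 : ℝ) / (1 / 2) = 1 := by norm_num
  have e3 : (1 / 2 : ℝ) ^ 2 / (1 / 2) = 1 / 2 := by norm_num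
  rw [e1, e2, e3, Real.log_one, log_half]
  simp only [chain, Finset.sum_range_succ, Finset.sum_range_zero, Nat.factorial]
  norm_num
  ring

lemma dilog_half : 2 * li 2 (1 / 2) + Real.log 2 ^ 2 = li 2 1 := by
  have h := eq_of_hasDerivAt_zero_of_tendsto (f := fun r : ℝ =>
      chain (fun j => pl (fun _ => 1) (j + 1) (1 * r)) (Real.log r + 0) 0
      + chain (fun j => pl (fun _ => 1) (j + 1) (1 - r)) (Real.log (1 - r)) 0
      + (Real.log r + 0) * Real.log (1 - r)) (b := 1 / 2) (ℓ := li 2 1) (by norm_num) ?_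
    (fun r hr => ?_) ?_
  · simp only [chain, Finset.sum_range_succ, Finset.sum_range_zero, Nat.factorial, log_half,
      (by norm_num : (1 : ℝ) - 1 / 2 = 1 / 2)] at h
    norm_num at h
    rw [li] at *
    linear_combination h
  · refine ((continuousOn_chain_id sqrtGrowth_one le_rfl 0 0).add
      ((continuousOn_chain_one_sub sqrtGrowth_one le_rfl 0).mono Set.Ioc_subset_Icc_self)).add
      (ContinuousOn.mul (fun r hr => ?_) fun r hr => ?_)
    · exact (hasDerivAt_log_add 0 hr.1).continuousAt.continuousWithinAt
    · exact (hasDerivAt_log_one_sub (by linarith [hr.2])).continuousAt.continuousWithinAt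
  · have h1 : r < 1 := by linarith [hr.2]
    refine (((hasDerivAt_chain_id sqrtGrowth_one 1 0 0 hr.1 h1).fun_add
      (hasDerivAt_chain_one_sub sqrtGrowth_one 1 0 hr.1 h1)).fun_add
      ((hasDerivAt_log_add 0 hr.1).fun_mul (hasDerivAt_log_one_sub h1))).congr_deriv ?_
    have e6 := li_one_self hr.1 h1
    have e7 := li_one_one_sub hr.1 h1
    rw [li] at e6 e7
    rw [e6, e7]
    simp only [Nat.factorial]
    push_cast
    ring
  · have hid : Tendsto (fun r : ℝ => r) (𝓝[>] 0) (𝓝[>] 0) := tendsto_id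
    have h := ((tendsto_chain_pl sqrtGrowth_one le_rfl 0 0 1 hid).add
      (tendsto_chain_one_sub sqrtGrowth_one le_rfl 0)).add (tendsto_log_pow_mul_log_one_sub 1 0)
    simpa only [zero_add, add_zero, pow_one, li, Nat.reduceAdd] using h

lemma trilog_half :
    li 3 (-1) + 2 * li 3 (1 / 2) + 2 * Real.log 2 * li 2 (1 / 2) + 2 / 3 * Real.log 2 ^ 3
      = li 3 1 := by
  have h := eq_of_hasDerivAt_zero_of_tendsto (f := fun r : ℝ =>
      chain (fun j => pl (fun _ => 1) (j + 1) (-1 * (r / (1 - r)))) (Real.log (r / (1 - r)) + 0) 1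
      + chain (fun j => pl (fun _ => 1) (j + 1) (1 * r)) (Real.log r + 0) 1
      + chain (fun j => pl (fun _ => 1) (j + 1) (1 - r)) (Real.log (1 - r)) 1
      - (Real.log r + 0) * Real.log (1 - r) ^ 2 + Real.log (1 - r) ^ 3 / 3)
      (b := 1 / 2) (ℓ := li 3 1) (by norm_num) ?_
    (fun r hr => ?_) ?_
  · simp only [chain, Finset.sum_range_succ, Finset.sum_range_zero, Nat.factorial, log_half,
      (by norm_num : (1 : ℝ) - 1 / 2 = 1 / 2)] at h
    norm_num at h
    rw [li] at *
    linear_combination h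
  · have hb : ContinuousOn (fun r : ℝ => Real.log r + 0) (Set.Ioc 0 (1 / 2)) := fun r hr =>
      (hasDerivAt_log_add 0 hr.1).continuousAt.continuousWithinAt
    have ha : ContinuousOn (fun r : ℝ => Real.log (1 - r)) (Set.Ioc 0 (1 / 2)) := fun r hr =>
      (hasDerivAt_log_one_sub (by linarith [hr.2])).continuousAt.continuousWithinAt
    exact ((((continuousOn_chain_neg_div sqrtGrowth_one le_rfl 1 0).add
      (continuousOn_chain_id sqrtGrowth_one le_rfl 1 0)).add
      ((continuousOn_chain_one_sub sqrtGrowth_one le_rfl 1).mono Set.Ioc_subset_Icc_self)).sub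
      (hb.mul (ha.pow 2))).add ((ha.pow 3).div_const 3)
  · have h1 : r < 1 := by linarith [hr.2]
    have ha := hasDerivAt_log_one_sub h1
    refine (((((hasDerivAt_chain_neg_div sqrtGrowth_one 1 1 0 hr.1 hr.2).fun_add
      (hasDerivAt_chain_id sqrtGrowth_one 1 1 0 hr.1 h1)).fun_add
      (hasDerivAt_chain_one_sub sqrtGrowth_one 1 1 hr.1 h1)).fun_sub
      ((hasDerivAt_log_add 0 hr.1).fun_mul (ha.fun_pow 2))).fun_add
      ((ha.fun_pow 3).div_const 3)).congr_deriv ?_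
    have e5 := li_one_neg_div hr.1 hr.2
    have e6 := li_one_self hr.1 h1
    have e7 := li_one_one_sub hr.1 h1
    rw [li] at e5 e6 e7
    rw [e5, e6, e7, log_div_one_sub hr.1 h1]
    simp only [Nat.factorial]
    push_cast
    ring
  · have hid : Tendsto (fun r : ℝ => r) (𝓝[>] 0) (𝓝[>] 0) := tendsto_id
    have h := (((((tendsto_chain_pl sqrtGrowth_one le_rfl 1 0 (-1) tendsto_div_one_sub).add
      (tendsto_chain_pl sqrtGrowth_one le_rfl 1 0 1 hid)).add
      (tendsto_chain_one_sub sqrtGrowth_one le_rfl 1)).sub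
      ((tendsto_log_pow_mul_log_one_sub 1 0).mul tendsto_log_one_sub)).add
      ((tendsto_log_one_sub.pow 3).div_const 3))
    norm_num at h
    refine (h.congr fun r => ?_)
    simp only [one_mul, neg_mul, add_zero, sq, mul_assoc]

lemma li_neg_one (j : ℕ) : li (j + 2) (-1) = (2 / 2 ^ (j + 2) - 1) * li (j + 2) 1 := by
  have h1 := summable_pl sqrtGrowth_one (j := j + 2) (z := 1) (by omega) (by norm_num)
  have h2 := summable_pl sqrtGrowth_one (j := j + 2) (z := -1) (by omega) (by norm_num)
  let f : ℕ → ℝ := fun n => 1 * (-1) ^ (n + 1) / ((n : ℝ) + 1) ^ (j + 2)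
    + 1 * 1 ^ (n + 1) / ((n : ℝ) + 1) ^ (j + 2)
  have hev : ∀ k, f (2 * k) = 0 := fun k => by
    simp only [f, pow_succ (-1 : ℝ) (2 * k), pow_mul]
    norm_num
    ring
  have hodd : ∀ k, f (2 * k + 1)
      = 2 / 2 ^ (j + 2) * (1 * 1 ^ (k + 1) / ((k : ℝ) + 1) ^ (j + 2)) := fun k => by
    have e : ((2 * k + 1 : ℕ) : ℝ) + 1 = 2 * ((k : ℝ) + 1) := by push_cast; ring
    simp only [f, e, mul_pow, show 2 * k + 1 + 1 = 2 * (k + 1) by ring, pow_mul]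
    norm_num
    field_simp
    norm_num
  have key : li (j + 2) (-1) + li (j + 2) 1 = 2 / 2 ^ (j + 2) * li (j + 2) 1 :=
    calc li (j + 2) (-1) + li (j + 2) 1 = ∑' n, f n := (h2.tsum_add h1).symm
      _ = ∑' k, f (2 * k) + ∑' k, f (2 * k + 1) := by
        refine (tsum_even_add_odd ?_ ?_).symm
        · simp only [hev, summable_zero]
        · simp only [hodd]
          exact h1.mul_left _
      _ = 2 / 2 ^ (j + 2) * li (j + 2) 1 := by
        simp only [hev, hodd, tsum_zero, zero_add]
        exact tsum_mul_left
  linear_combination key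

/-- Euler's double zeta value `∑_{i<n} 1/(n^c i^a)`. -/
noncomputable def dz (c a : ℕ) : ℝ :=
  ∑' n : ℕ, (∑ i ∈ Finset.range n, 1 / ((i : ℝ) + 1) ^ a) / ((n : ℝ) + 1) ^ c

/-- The general term of Tornheim's double series. -/
noncomputable def tornheimTerm (a b c : ℕ) (p : ℕ × ℕ) : ℝ :=
  1 / (((p.1 : ℝ) + 1) ^ a * ((p.2 : ℝ) + 1) ^ b * ((p.1 : ℝ) + 1 + ((p.2 : ℝ) + 1)) ^ c)

/-- Tornheim's double series `∑ 1/(m^a k^b (m+k)^c)`. -/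
noncomputable def tornheim (a b c : ℕ) : ℝ := ∑' p : ℕ × ℕ, tornheimTerm a b c p

lemma sq_mul_sq_le {x y : ℝ} (hx : 1 ≤ x) (hy : 1 ≤ y) {a b c : ℕ} (i j : ℕ) (ha : 2 ≤ a + i)
    (hb : 2 ≤ b + j) (hij : i + j ≤ c) : x ^ 2 * y ^ 2 ≤ x ^ a * y ^ b * (x + y) ^ c :=
  calc x ^ 2 * y ^ 2 ≤ x ^ (a + i) * y ^ (b + j) := by gcongr
    _ = x ^ a * y ^ b * (x ^ i * y ^ j) := by ring
    _ ≤ x ^ a * y ^ b * ((x + y) ^ i * (x + y) ^ j) := by gcongr <;> linarith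
    _ = x ^ a * y ^ b * (x + y) ^ (i + j) := by ring
    _ ≤ x ^ a * y ^ b * (x + y) ^ c := by gcongr; linarith

lemma summable_tornheimTerm {a b c : ℕ} (i j : ℕ) (ha : 2 ≤ a + i) (hb : 2 ≤ b + j)
    (hij : i + j ≤ c) : Summable (tornheimTerm a b c) := by
  have h1 : Summable fun n : ℕ => 1 / ((n : ℝ) + 1) ^ 2 := by
    simpa using summable_pl sqrtGrowth_one (j := 2) (z := 1) le_rfl (by norm_num)
  have h2 := h1.mul_of_nonneg h1 (fun n => by positivity) fun n => by positivity
  refine Summable.of_nonneg_of_le (fun p => by unfold tornheimTerm; positivity) (fun p => ?_) h2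
  rw [one_div_mul_one_div]
  exact one_div_le_one_div_of_le (by positivity)
    (sq_mul_sq_le (by simp) (by simp) i j ha hb hij)

lemma tornheim_succ {a b c : ℕ} (h1 : Summable (tornheimTerm a (b + 1) (c + 1)))
    (h2 : Summable (tornheimTerm (a + 1) b (c + 1))) :
    tornheim (a + 1) (b + 1) c = tornheim a (b + 1) (c + 1) + tornheim (a + 1) b (c + 1) := by
  rw [tornheim, tornheim, tornheim, ← h1.tsum_add h2]
  refine tsum_congr fun p => ?_
  have h : (p.1 : ℝ) + 1 + ((p.2 : ℝ) + 1) ≠ 0 := by positivity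
  simp only [tornheimTerm]
  field_simp
  ring

lemma tornheim_symm (a b c : ℕ) : tornheim a b c = tornheim b a c := by
  rw [tornheim, ← (Equiv.prodComm ℕ ℕ).tsum_eq]
  refine tsum_congr fun p => ?_
  simp only [tornheimTerm, Equiv.prodComm_apply, Prod.fst_swap, Prod.snd_swap]
  ring

lemma hasSum_dz {a c : ℕ} (h : Summable (tornheimTerm a 0 c)) :
    HasSum (fun n : ℕ => (∑ i ∈ Finset.range n, 1 / ((i : ℝ) + 1) ^ a) / ((n : ℝ) + 1) ^ c)
      (tornheim a 0 c) := by
  have h1 := (Finset.HasAntidiagonal.sigmaAntidiagonalEquivProd (A := ℕ)).hasSum_iff.2 h.hasSum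
  have h2 := h1.sigma fun n =>
    (Finset.HasAntidiagonal.antidiagonal n).hasSum (tornheimTerm a 0 c)
  rw [← hasSum_nat_add_iff' 1]
  simp only [Finset.sum_range_one, Finset.sum_range_zero, zero_div, sub_zero]
  convert! h2 using 1
  funext n
  rw [Finset.Nat.sum_antidiagonal_eq_sum_range_succ_mk, Finset.sum_div]
  refine Finset.sum_congr rfl fun i hi => ?_
  have hi' : i ≤ n := Nat.lt_succ_iff.1 (Finset.mem_range.1 hi)
  simp only [tornheimTerm]
  push_cast [hi']
  rw [pow_zero, mul_one, div_div]
  ring_nf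

lemma dz_eq {a c : ℕ} (h : Summable (tornheimTerm a 0 c)) : dz c a = tornheim a 0 c :=
  (hasSum_dz h).tsum_eq

lemma li_mul_li {a b : ℕ} (ha : 2 ≤ a) (hb : 2 ≤ b) (h1 : Summable (tornheimTerm a 0 b))
    (h2 : Summable (tornheimTerm b 0 a)) :
    li a 1 * li b 1 = tornheim a 0 b + tornheim b 0 a + li (a + b) 1 := by
  have hs (j : ℕ) (hj : 2 ≤ j) : HasSum (fun n : ℕ => 1 / ((n : ℝ) + 1) ^ j) (li j 1) := by
    simpa [li, pl] using (summable_pl sqrtGrowth_one (j := j) (z := 1) hj (by norm_num)).hasSum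
  have hp := (hs a ha).tendsto_sum_nat.mul (hs b hb).tendsto_sum_nat
  have hq := (((hasSum_dz h1).add (hasSum_dz h2)).add (hs (a + b) (by omega))).tendsto_sum_nat
  refine tendsto_nhds_unique hp (hq.congr fun N => ?_)
  induction N with
  | zero => simp
  | succ N ih =>
    rw [Finset.sum_range_succ, ih, Finset.sum_range_succ, Finset.sum_range_succ, pow_add]
    field_simp
    ring

lemma hasSum_sub_shift {g : ℕ → ℝ} (hg : Antitone g) (h0 : Tendsto g atTop (𝓝 0)) (p : ℕ) :
    HasSum (fun k => g k - g (k + p)) (∑ i ∈ Finset.range p, g i) := by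
  rw [hasSum_iff_tendsto_nat_of_nonneg fun k => sub_nonneg.2 (hg (Nat.le_add_right k p))]
  have h : Tendsto (fun N => ∑ i ∈ Finset.range p, g i - ∑ i ∈ Finset.range p, g (N + i)) atTop
      (𝓝 (∑ i ∈ Finset.range p, g i - ∑ i ∈ Finset.range p, 0)) :=
    tendsto_const_nhds.sub
      (tendsto_finsetSum _ fun i _ => h0.comp (tendsto_add_atTop_nat i))
  rw [Finset.sum_const_zero, sub_zero] at h
  refine h.congr fun N => ?_
  have e1 := Finset.sum_range_add g p N
  have e2 := Finset.sum_range_add g N p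
  rw [add_comm p N, e2] at e1
  rw [Finset.sum_sub_distrib]
  simp only [add_comm _ p]
  linarith

lemma tornheim_four_one_one : tornheim 4 1 1 = li 6 1 + nl 5 1 := by
  have hs := summable_tornheimTerm (a := 4) (b := 1) (c := 1) 0 1 (by norm_num) (by norm_num)
    (by norm_num)
  have h1 := summable_pl sqrtGrowth_one (j := 6) (z := 1) (by norm_num) (by norm_num)
  have h2 := summable_pl sqrtGrowth_harm (j := 5) (z := 1) (by norm_num) (by norm_num)
  rw [tornheim, hs.tsum_prod, li, nl, pl, pl, ← h1.tsum_add h2]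
  refine tsum_congr fun m => ?_
  have ha : Antitone fun n : ℕ => 1 / ((n : ℝ) + 1) := fun x y h =>
    one_div_le_one_div_of_le (by positivity) (by gcongr)
  have h := (hasSum_sub_shift ha tendsto_one_div_add_atTop_nhds_zero_nat (m + 1)).div_const
    (((m : ℝ) + 1) ^ 5)
  have e := harm_succ m
  rw [harm] at e
  rw [e] at h
  refine (h.tsum_eq.symm.trans (tsum_congr fun k => ?_)).symm.trans ?_
  · simp only [tornheimTerm]
    push_cast
    field_simp
    ring
  · field_simp
    ring

lemma nl_five_one :
    nl 5 1 = 5 / 2 * li 6 1 - li 2 1 * li 4 1 - li 3 1 ^ 2 / 2 := by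
  have s402 := summable_tornheimTerm (a := 4) (b := 0) (c := 2) 0 2 (by norm_num) (by norm_num)
    (by norm_num)
  have s303 := summable_tornheimTerm (a := 3) (b := 0) (c := 3) 0 2 (by norm_num) (by norm_num)
    (by norm_num)
  have s204 := summable_tornheimTerm (a := 2) (b := 0) (c := 4) 0 2 (by norm_num) (by norm_num)
    (by norm_num)
  have s105 := summable_tornheimTerm (a := 1) (b := 0) (c := 5) 1 2 (by norm_num) (by norm_num)
    (by norm_num)
  have s015 := summable_tornheimTerm (a := 0) (b := 1) (c := 5) 2 1 (by norm_num) (by norm_num)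
    (by norm_num)
  have s114 := summable_tornheimTerm (a := 1) (b := 1) (c := 4) 1 1 (by norm_num) (by norm_num)
    (by norm_num)
  have s213 := summable_tornheimTerm (a := 2) (b := 1) (c := 3) 0 1 (by norm_num) (by norm_num)
    (by norm_num)
  have s312 := summable_tornheimTerm (a := 3) (b := 1) (c := 2) 0 1 (by norm_num) (by norm_num)
    (by norm_num)
  have e1 := tornheim_succ s312 s402
  have e2 := tornheim_succ s213 s303
  have e3 := tornheim_succ s114 s204
  have e4 := tornheim_succ s015 s105
  have e5 := tornheim_symm 0 1 5
  have e6 := li_mul_li (by norm_num) (by norm_num) s204 s402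
  have e7 := li_mul_li (by norm_num) (by norm_num) s303 s303
  have e8 : nl 5 1 = tornheim 1 0 5 := by
    rw [← dz_eq s105, nl, pl, dz]
    simp [harm]
  have e9 := tornheim_four_one_one
  norm_num at *
  linarith

lemma li_one_eq_tsum {k : ℕ} (hk : 2 ≤ k) : li k 1 = ∑' n : ℕ, 1 / (n : ℝ) ^ k := by
  rw [(Real.summable_one_div_nat_pow.2 (by omega)).tsum_eq_zero_add, li, pl]
  simp [show k ≠ 0 by omega]

lemma riemannZeta_eq_li {k : ℕ} (hk : 2 ≤ k) : riemannZeta k = (li k 1 : ℂ) := by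
  rw [zeta_nat_eq_tsum_of_gt_one (by omega), li_one_eq_tsum hk]
  push_cast
  rfl

lemma li_two_one : li 2 1 = Real.pi ^ 2 / 6 := by
  rw [li_one_eq_tsum le_rfl, hasSum_zeta_two.tsum_eq]

lemma li_four_one : li 4 1 = Real.pi ^ 4 / 90 := by
  rw [li_one_eq_tsum (by norm_num), hasSum_zeta_four.tsum_eq]

lemma bernoulli'_five : bernoulli' 5 = 0 := by
  rw [bernoulli'_def]
  norm_num [Finset.sum_range_succ, Nat.choose]

lemma bernoulli'_six : bernoulli' 6 = 1 / 42 := by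
  rw [bernoulli'_def]
  norm_num [Finset.sum_range_succ, Nat.choose, bernoulli'_five]

lemma li_six_one : li 6 1 = Real.pi ^ 6 / 945 := by
  rw [li_one_eq_tsum (by norm_num), (hasSum_zeta_nat (k := 3) (by norm_num)).tsum_eq,
    bernoulli_eq_bernoulli'_of_ne_one (by norm_num), bernoulli'_six]
  norm_num [Nat.factorial]
  ring

lemma rpolylog_eq_li (s : ℕ) (x : ℝ) : rpolylog s x = li s x := by
  simp [rpolylog, li, pl]

lemma S6_eq_ql : S6 = ql 6 (1 / 2) := by
  rw [S6, ql, pl]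
  refine tsum_congr fun n => ?_
  have h : (Nat.choose (2 * (n + 1)) (n + 1) : ℝ) ≠ 0 := by
    exact_mod_cast (Nat.choose_pos (by omega)).ne'
  rw [binomCoeff, div_pow, one_pow]
  push_cast
  field_simp

lemma sum_Ico_one_eq_harm (n : ℕ) : ∑ m ∈ Finset.Ico 1 (n + 1), (1 : ℝ) / (m : ℝ) = harm n := by
  rw [Finset.sum_Ico_eq_sum_range, harm]
  refine Finset.sum_congr rfl fun i _ => ?_
  push_cast
  rw [add_comm]

lemma zetaBar5_1_eq_nl : zetaBar5_1 = nl 5 (-1) := by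
  have e : ∀ n : ℕ, ((-1 : ℝ) ^ (n + 1) / ((n + 1 : ℕ) : ℝ) ^ 5)
      * ∑ m ∈ Finset.Ico 1 (n + 1), (1 : ℝ) / (m : ℝ)
      = harm n * (-1) ^ (n + 1) / ((n : ℝ) + 1) ^ 5 := fun n => by
    rw [sum_Ico_one_eq_harm]
    push_cast
    ring
  have hs := summable_pl sqrtGrowth_harm (j := 5) (z := -1) (by norm_num) (by norm_num)
  rw [zetaBar5_1, Summable.tsum_eq_zero_add]
  · simp only [e]
    simp [nl, pl]
  · refine (summable_nat_add_iff 1).1 ?_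
    simpa only [e] using hs

lemma zetaBar5_1_eq :
    zetaBar5_1
      = 8 * rpolylog 6 (1 / 2) + 3 * rpolylog 5 (1 / 2) * Real.log 2
        + S6 / 2 + li 3 1 ^ 2 / 2 - 1 / 6 * li 3 1 * Real.log 2 ^ 3
        + 19 / 4 * li 5 1 * Real.log 2
        - Real.pi ^ 6 / 112 - 19 / 1440 * Real.log 2 ^ 6
        + 1 / 72 * Real.pi ^ 2 * Real.log 2 ^ 4
        - 7 / 720 * Real.pi ^ 4 * Real.log 2 ^ 2 := by
  have h := main_half_expanded
  have n2 := li_neg_one 0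
  have n3 := li_neg_one 1
  have n4 := li_neg_one 2
  have n5 := li_neg_one 3
  have n6 := li_neg_one 4
  have h2 := dilog_half
  have h3 := trilog_half
  have hE := nl_five_one
  simp only [Nat.reduceAdd] at n2 n3 n4 n5 n6
  have h2' : li 2 (1 / 2) = (li 2 1 - Real.log 2 ^ 2) / 2 := by linarith
  have h3' : li 3 (1 / 2) = (li 3 1 - li 3 (-1) - 2 * Real.log 2 * li 2 (1 / 2)
    - 2 / 3 * Real.log 2 ^ 3) / 2 := by linarith
  rw [hE, h3', h2', n2, n3, n4, n5, n6, li_two_one, li_four_one, li_six_one] at h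
  rw [zetaBar5_1_eq_nl, S6_eq_ql, rpolylog_eq_li, rpolylog_eq_li]
  norm_num at h ⊢
  linear_combination h / 12

end AltDoubleZeta

/-- `ζ(5̄,1) = 8·Li₆(1/2) + 3·Li₅(1/2)·log 2 + S₆/2 + ζ(3)²/2
− (1/6)ζ(3)log³2 + (19/4)ζ(5)·log 2 − π⁶/112 − (19/1440)log⁶2 + (1/72)π²log⁴2
− (7/720)π⁴log²2`. -/
theorem statement17 :
    ((zetaBar5_1 : ℝ) : ℂ)
      = 8 * (rpolylog 6 (1 / 2) : ℂ) + 3 * (rpolylog 5 (1 / 2) : ℂ) * (Real.log 2 : ℂ)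
        + (S6 : ℂ) / 2 + riemannZeta 3 ^ 2 / 2
        - 1 / 6 * riemannZeta 3 * (Real.log 2 : ℂ) ^ 3
        + 19 / 4 * riemannZeta 5 * (Real.log 2 : ℂ)
        - (Real.pi : ℂ) ^ 6 / 112 - 19 / 1440 * (Real.log 2 : ℂ) ^ 6
        + 1 / 72 * (Real.pi : ℂ) ^ 2 * (Real.log 2 : ℂ) ^ 4
        - 7 / 720 * (Real.pi : ℂ) ^ 4 * (Real.log 2 : ℂ) ^ 2 := by
  have h3 : riemannZeta 3 = (AltDoubleZeta.li 3 1 : ℂ) := by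
    exact_mod_cast AltDoubleZeta.riemannZeta_eq_li (k := 3) (by norm_num)
  have h5 : riemannZeta 5 = (AltDoubleZeta.li 5 1 : ℂ) := by
    exact_mod_cast AltDoubleZeta.riemannZeta_eq_li (k := 5) (by norm_num)
  rw [h3, h5, AltDoubleZeta.zetaBar5_1_eq]
  push_cast
  ring
end
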